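/- arXiv:1110.0699 — 3 statements merged into one kernel-verified Lean document; each statement's English description precedes it below -/
import Mathlib

section
/- Let α be a continuous action of a countable sofic group G on a compact metrizable space X, let Σ be a sofic approximation sequence for G, let ρ be a compatible metric on X, and let f : X → ℝ be continuous. Then P_{Σ,∞}(f,X,G,ρ) = sup { h_{Σ,μ,∞}(ρ) + ∫_X f dμ : μ ∈ M_G(X) } (where the supremum of the empty set is −∞). In particular, if P_{Σ,∞}(f,X,G,ρ) ≠ −∞ then M_G(X) is nonempty. -/
open Filter MeasureTheory
open scoped Pointwise Classical BigOperators

namespace Sofic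

structure ContAction (G : Type*) [Group G] (X : Type*) [TopologicalSpace X]
    (α : G → X → X) : Prop where
  one : ∀ x, α 1 x = x
  mul : ∀ s t x, α (s * t) x = α s (α t x)
  cont : ∀ s, Continuous (α s)

structure IsContPseudoMetric (X : Type*) [TopologicalSpace X] (ρ : X → X → ℝ) : Prop where
  nonneg : ∀ x y, 0 ≤ ρ x y
  refl : ∀ x, ρ x x = 0
  symm : ∀ x y, ρ x y = ρ y x
  triangle : ∀ x y z, ρ x z ≤ ρ x y + ρ y z
  cont : Continuous fun p : X × X => ρ p.1 p.2

structure IsCompatMetric (X : Type*) [TopologicalSpace X] (ρ : X → X → ℝ)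
    extends IsContPseudoMetric X ρ : Prop where
  eq_of_zero : ∀ x y, ρ x y = 0 → x = y
  ball_mem : ∀ x : X, ∀ U ∈ nhds x, ∃ ε > 0, {y | ρ x y < ε} ⊆ U

structure IsSoficApprox (G : Type*) [Group G] (d : ℕ → ℕ)
    (σ : ∀ i, G → Equiv.Perm (Fin (d i))) : Prop where
  mul : ∀ s t : G, Tendsto
    (fun i => ((Finset.univ.filter fun a : Fin (d i) => σ i s (σ i t a) = σ i (s * t) a).card : ℝ) / (d i : ℝ))
    atTop (nhds 1)
  sep : ∀ s t : G, s ≠ t → Tendsto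
    (fun i => ((Finset.univ.filter fun a : Fin (d i) => σ i s a ≠ σ i t a).card : ℝ) / (d i : ℝ))
    atTop (nhds 1)
  dim_top : Tendsto d atTop atTop

noncomputable def rho2 {X : Type*} (ρ : X → X → ℝ) {d : ℕ} (φ ψ : Fin d → X) : ℝ :=
  Real.sqrt ((1 / (d : ℝ)) * ∑ a, (ρ (φ a) (ψ a)) ^ 2)

noncomputable def rhoInf {X : Type*} (ρ : X → X → ℝ) {d : ℕ} (φ ψ : Fin d → X) : ℝ :=
  ⨆ a : Fin d, ρ (φ a) (ψ a)

def MapSet {G X : Type*} [Group G] (α : G → X → X) (ρ : X → X → ℝ)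
    (F : Finset G) (δ : ℝ) {d : ℕ} (σ : G → Equiv.Perm (Fin d)) : Set (Fin d → X) :=
  {φ | ∀ s ∈ F, rho2 ρ (fun a => α s (φ a)) (fun a => φ (σ s a)) < δ}

noncomputable def Mval {G X : Type*} [Group G] (α : G → X → X) (f : X → ℝ) (ρ : X → X → ℝ)
    (ε : ℝ) (F : Finset G) (δ : ℝ) {d : ℕ} (σ : G → Equiv.Perm (Fin d))
    (sepd : (Fin d → X) → (Fin d → X) → ℝ) : ℝ :=
  sSup {r : ℝ | ∃ E : Finset (Fin d → X), ↑E ⊆ MapSet α ρ F δ σ ∧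
    (∀ φ ∈ E, ∀ ψ ∈ E, φ ≠ ψ → ε ≤ sepd φ ψ) ∧
    r = ∑ φ ∈ E, Real.exp (∑ a, f (φ a))}

noncomputable def PressureInf {G X : Type*} [Group G] (α : G → X → X) (f : X → ℝ)
    (ρ : X → X → ℝ) (d : ℕ → ℕ) (σ : ∀ i, G → Equiv.Perm (Fin (d i))) : EReal :=
  ⨆ (ε : ℝ) (_ : 0 < ε), ⨅ (F : Finset G) (_ : F.Nonempty), ⨅ (δ : ℝ) (_ : 0 < δ),
    Filter.limsup (fun i =>
      if (MapSet α ρ F δ (σ i)).Nonempty then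
        (((Real.log (Mval α f ρ ε F δ (σ i) (rhoInf ρ))) / (d i : ℝ) : ℝ) : EReal)
      else (⊥ : EReal)) atTop

noncomputable def Pressure2 {G X : Type*} [Group G] (α : G → X → X) (f : X → ℝ)
    (ρ : X → X → ℝ) (d : ℕ → ℕ) (σ : ∀ i, G → Equiv.Perm (Fin (d i))) : EReal :=
  ⨆ (ε : ℝ) (_ : 0 < ε), ⨅ (F : Finset G) (_ : F.Nonempty), ⨅ (δ : ℝ) (_ : 0 < δ),
    Filter.limsup (fun i =>
      if (MapSet α ρ F δ (σ i)).Nonempty then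
        (((Real.log (Mval α f ρ ε F δ (σ i) (rho2 ρ))) / (d i : ℝ) : ℝ) : EReal)
      else (⊥ : EReal)) atTop

def MapMuSet {G X : Type*} [Group G] [TopologicalSpace X] [MeasurableSpace X]
    (α : G → X → X) (μ : Measure X) (ρ : X → X → ℝ) (F : Finset G)
    (L : Finset C(X, ℝ)) (δ : ℝ) {d : ℕ} (σ : G → Equiv.Perm (Fin d)) : Set (Fin d → X) :=
  {φ | φ ∈ MapSet α ρ F δ σ ∧
    ∀ g ∈ L, |(1 / (d : ℝ)) * ∑ j, g (φ j) - ∫ x, g x ∂μ| < δ}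

noncomputable def Nval {X : Type*} (ε : ℝ) {d : ℕ} (Y : Set (Fin d → X))
    (sepd : (Fin d → X) → (Fin d → X) → ℝ) : ℝ :=
  sSup {r : ℝ | ∃ E : Finset (Fin d → X), ↑E ⊆ Y ∧
    (∀ φ ∈ E, ∀ ψ ∈ E, φ ≠ ψ → ε ≤ sepd φ ψ) ∧ r = (E.card : ℝ)}

noncomputable def MeasEntropy {G X : Type*} [Group G] [TopologicalSpace X] [MeasurableSpace X]
    (α : G → X → X) (μ : Measure X) (ρ : X → X → ℝ) (d : ℕ → ℕ)
    (σ : ∀ i, G → Equiv.Perm (Fin (d i))) : EReal :=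
  ⨆ (ε : ℝ) (_ : 0 < ε), ⨅ (F : Finset G) (_ : F.Nonempty),
    ⨅ (L : Finset C(X, ℝ)) (_ : L.Nonempty), ⨅ (δ : ℝ) (_ : 0 < δ),
      Filter.limsup (fun i =>
        if (MapMuSet α μ ρ F L δ (σ i)).Nonempty then
          (((Real.log (Nval ε (MapMuSet α μ ρ F L δ (σ i)) (rhoInf ρ))) / (d i : ℝ) : ℝ) : EReal)
        else (⊥ : EReal)) atTop

def IsInvProb {G X : Type*} [Group G] [MeasurableSpace X]
    (α : G → X → X) (μ : Measure X) : Prop :=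
  IsProbabilityMeasure μ ∧ ∀ s : G, Measure.map (α s) μ = μ

noncomputable def Kval {G X : Type*} [Group G] (α : G → X → X) (f : X → ℝ)
    (ρ : X → X → ℝ) (ε : ℝ) (F : Finset G) : ℝ :=
  sSup {r : ℝ | ∃ D : Finset X,
    (∀ x ∈ D, ∀ y ∈ D, x ≠ y → ε ≤ ⨆ s ∈ F, ρ (α s x) (α s y)) ∧
    r = ∑ x ∈ D, Real.exp (∑ s ∈ F, f (α s x))}

def IsFolnerSeq (G : Type*) [Group G] [DecidableEq G] (Fol : ℕ → Finset G) : Prop :=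
  (∀ n, (Fol n).Nonempty) ∧ ∀ s : G,
    Tendsto (fun n =>
      (((((Fol n).image fun t => s * t) \ Fol n) ∪ (Fol n \ ((Fol n).image fun t => s * t))).card : ℝ)
        / ((Fol n).card : ℝ)) atTop (nhds 0)

section Separation

variable {X : Type*} {ρ : X → X → ℝ}

theorem rhoInf_lt_of_forall_lt {d : ℕ} {ε : ℝ} (hε : 0 < ε) {φ ψ : Fin d → X}
    (h : ∀ a, ρ (φ a) (ψ a) < ε) : rhoInf ρ φ ψ < ε := by
  unfold rhoInf
  rcases isEmpty_or_nonempty (Fin d) with hd | hd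
  · rwa [Real.iSup_of_isEmpty]
  · obtain ⟨a, ha⟩ := exists_eq_ciSup_of_finite (f := fun a => ρ (φ a) (ψ a))
    rw [← ha]
    exact h a

variable [TopologicalSpace X] [CompactSpace X]

/-- Separated families of maps `Fin d → X` grow at most exponentially in `d`. -/
theorem exists_card_le_pow (hρ : IsContPseudoMetric X ρ) {ε : ℝ} (hε : 0 < ε) :
    ∃ K : ℕ, ∀ (d : ℕ) (E : Finset (Fin d → X)),
      (∀ φ ∈ E, ∀ ψ ∈ E, φ ≠ ψ → ε ≤ rhoInf ρ φ ψ) → E.card ≤ K ^ d := by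
  have hopen : ∀ x : X, IsOpen {y | ρ x y < ε / 2} := fun x =>
    isOpen_lt (hρ.cont.comp (Continuous.prodMk_right x)) continuous_const
  obtain ⟨T, hT⟩ := isCompact_univ.elim_finite_subcover (fun x : X => {y | ρ x y < ε / 2}) hopen
    fun y _ => Set.mem_iUnion.2 ⟨y, by simpa [hρ.refl] using half_pos hε⟩
  have hcenter : ∀ y : X, ∃ x : T, ρ x y < ε / 2 := fun y => by
    obtain ⟨x, hx, hxy⟩ := Set.mem_iUnion₂.1 (hT (Set.mem_univ y))
    exact ⟨⟨x, hx⟩, hxy⟩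
  choose c hc using hcenter
  refine ⟨T.card, fun d E hE => ?_⟩
  have hinj : Set.InjOn (fun (φ : Fin d → X) (a : Fin d) => c (φ a)) E := by
    intro φ hφ ψ hψ heq
    by_contra hne
    refine (hE φ hφ ψ hψ hne).not_gt (rhoInf_lt_of_forall_lt hε fun a => ?_)
    have h₁ := hc (φ a)
    have h₂ := hc (ψ a)
    rw [← show c (φ a) = c (ψ a) from congrFun heq a] at h₂
    have h₃ := hρ.triangle (φ a) (c (φ a)) (ψ a)
    rw [hρ.symm (φ a) (c (φ a))] at h₃
    linarith
  calc E.card ≤ (Finset.univ : Finset (Fin d → T)).card :=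
        Finset.card_le_card_of_injOn _ (fun _ _ => Finset.mem_univ _) hinj
    _ = T.card ^ d := by simp

theorem card_le_Nval (hρ : IsContPseudoMetric X ρ) {ε : ℝ} (hε : 0 < ε) {d : ℕ}
    {Y : Set (Fin d → X)} {E : Finset (Fin d → X)} (hEY : ↑E ⊆ Y)
    (hE : ∀ φ ∈ E, ∀ ψ ∈ E, φ ≠ ψ → ε ≤ rhoInf ρ φ ψ) :
    (E.card : ℝ) ≤ Nval ε Y (rhoInf ρ) := by
  obtain ⟨K, hK⟩ := exists_card_le_pow hρ hε
  refine le_csSup ⟨((K ^ d : ℕ) : ℝ), ?_⟩ ⟨E, hEY, hE, rfl⟩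
  rintro _ ⟨E', -, hE', rfl⟩
  exact_mod_cast hK d E' hE'

theorem one_le_Nval (hρ : IsContPseudoMetric X ρ) {ε : ℝ} (hε : 0 < ε) {d : ℕ}
    {Y : Set (Fin d → X)} (hY : Y.Nonempty) : 1 ≤ Nval ε Y (rhoInf ρ) := by
  obtain ⟨φ, hφ⟩ := hY
  simpa using card_le_Nval hρ hε (E := {φ}) (by simpa using hφ) (by simp)

variable {G : Type*} [Group G] {α : G → X → X} {f : X → ℝ}

theorem sum_exp_le_Mval (hρ : IsContPseudoMetric X ρ) (hf : Continuous f) {ε : ℝ} (hε : 0 < ε)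
    {F : Finset G} {δ : ℝ} {d : ℕ} {σ : G → Equiv.Perm (Fin d)} {E : Finset (Fin d → X)}
    (hEM : ↑E ⊆ MapSet α ρ F δ σ) (hE : ∀ φ ∈ E, ∀ ψ ∈ E, φ ≠ ψ → ε ≤ rhoInf ρ φ ψ) :
    ∑ φ ∈ E, Real.exp (∑ a, f (φ a)) ≤ Mval α f ρ ε F δ σ (rhoInf ρ) := by
  obtain ⟨K, hK⟩ := exists_card_le_pow hρ hε
  obtain ⟨C, hC⟩ := (isCompact_range hf).bddAbove
  refine le_csSup ⟨((K ^ d : ℕ) : ℝ) * Real.exp (∑ _a : Fin d, C), ?_⟩ ⟨E, hEM, hE, rfl⟩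
  rintro _ ⟨E', -, hE', rfl⟩
  calc ∑ φ ∈ E', Real.exp (∑ a, f (φ a))
      ≤ ∑ _φ ∈ E', Real.exp (∑ _a : Fin d, C) := by
        gcongr with φ _ a
        exact hC ⟨_, rfl⟩
    _ = (E'.card : ℝ) * Real.exp (∑ _a : Fin d, C) := by simp
    _ ≤ _ := by
        gcongr
        exact hK d E' hE'

theorem Mval_pos (hρ : IsContPseudoMetric X ρ) (hf : Continuous f) {ε : ℝ} (hε : 0 < ε)
    {F : Finset G} {δ : ℝ} {d : ℕ} {σ : G → Equiv.Perm (Fin d)}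
    (hM : (MapSet α ρ F δ σ).Nonempty) : 0 < Mval α f ρ ε F δ σ (rhoInf ρ) := by
  obtain ⟨φ, hφ⟩ := hM
  refine (Real.exp_pos (∑ a, f (φ a))).trans_le ?_
  simpa using sum_exp_le_Mval hρ hf hε (E := {φ}) (by simpa using hφ) (by simp)

end Separation

section Equivariance

variable {X : Type*} {ρ : X → X → ℝ}

theorem rho2_sq {d : ℕ} (φ ψ : Fin d → X) :
    rho2 ρ φ ψ ^ 2 = (1 / (d : ℝ)) * ∑ a, ρ (φ a) (ψ a) ^ 2 :=
  Real.sq_sqrt (mul_nonneg (by positivity) (Finset.sum_nonneg fun _ _ => sq_nonneg _))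

variable [TopologicalSpace X] [CompactSpace X]

theorem exists_abs_sub_le_add_mul_sq (hρ : IsCompatMetric X ρ) {g : X → ℝ} (hg : Continuous g)
    {η : ℝ} (hη : 0 < η) : ∃ C, 0 < C ∧ ∀ x y, |g x - g y| ≤ η + C * ρ x y ^ 2 := by
  have hcont : Continuous fun p : X × X => |g p.1 - g p.2| := by fun_prop
  obtain ⟨B, hB⟩ := (isCompact_range hcont).bddAbove
  replace hB : ∀ x y, |g x - g y| ≤ B := fun x y => hB ⟨(x, y), rfl⟩
  have hcomp : IsCompact {p : X × X | η ≤ |g p.1 - g p.2|} :=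
    (isClosed_le continuous_const hcont).isCompact
  rcases Set.eq_empty_or_nonempty {p : X × X | η ≤ |g p.1 - g p.2|} with hemp | hne
  · refine ⟨1, one_pos, fun x y => ?_⟩
    have : |g x - g y| < η := by
      by_contra! h
      exact (hemp ▸ (show (x, y) ∈ {p : X × X | η ≤ |g p.1 - g p.2|} from h) :
        (x, y) ∈ (∅ : Set (X × X)))
    nlinarith [sq_nonneg (ρ x y)]
  obtain ⟨⟨x₀, y₀⟩, h₀, hmin⟩ := hcomp.exists_isMinOn hne hρ.cont.continuousOn
  have hpos : 0 < ρ x₀ y₀ := by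
    refine lt_of_le_of_ne (hρ.nonneg _ _) fun h => ?_
    have h₁ : η ≤ |g x₀ - g y₀| := h₀
    rw [hρ.eq_of_zero _ _ h.symm, sub_self, abs_zero] at h₁
    exact h₁.not_gt hη
  have hBpos : 0 < B := hη.trans_le ((show η ≤ |g x₀ - g y₀| from h₀).trans (hB _ _))
  refine ⟨B / ρ x₀ y₀ ^ 2, by positivity, fun x y => ?_⟩
  rcases lt_or_ge |g x - g y| η with h | h
  · have : 0 ≤ B / ρ x₀ y₀ ^ 2 * ρ x y ^ 2 := by positivity
    linarith
  · have hle : ρ x₀ y₀ ≤ ρ x y := hmin (show (x, y) ∈ {p : X × X | η ≤ |g p.1 - g p.2|} from h)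
    have : B ≤ B / ρ x₀ y₀ ^ 2 * ρ x y ^ 2 := by
      rw [div_mul_eq_mul_div, le_div_iff₀ (by positivity)]
      gcongr
    linarith [hB x y]

/-- Almost equivariant maps have almost invariant empirical measures. -/
theorem exists_abs_avg_sub_avg_le {G : Type*} [Group G] (α : G → X → X) (hρ : IsCompatMetric X ρ)
    {g : X → ℝ} (hg : Continuous g) (s : G) {η : ℝ} (hη : 0 < η) :
    ∃ δ, 0 < δ ∧ ∀ (d : ℕ) (σ : G → Equiv.Perm (Fin d)) (φ : Fin d → X), φ ∈ MapSet α ρ {s} δ σ →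
      |(1 / (d : ℝ)) * ∑ a, g (α s (φ a)) - (1 / (d : ℝ)) * ∑ a, g (φ a)| ≤ η := by
  obtain ⟨C, hC, hgC⟩ := exists_abs_sub_le_add_mul_sq hρ hg (half_pos hη)
  refine ⟨√(η / 2 / C), by positivity, fun d σ φ hφ => ?_⟩
  have hr : rho2 ρ (fun a => α s (φ a)) (fun a => φ (σ s a)) ^ 2 ≤ η / 2 / C := by
    rw [← Real.sq_sqrt (show 0 ≤ η / 2 / C by positivity)]
    exact pow_le_pow_left₀ (Real.sqrt_nonneg _) (hφ s (Finset.mem_singleton_self s)).le 2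
  rw [rho2_sq] at hr
  rw [← Equiv.sum_comp (σ s) (fun a => g (φ a)), ← mul_sub, ← Finset.sum_sub_distrib, abs_mul,
    abs_of_nonneg (show 0 ≤ 1 / (d : ℝ) by positivity)]
  have hd : 1 / (d : ℝ) * d ≤ 1 := by
    rw [one_div]
    exact inv_mul_le_one
  calc (1 / (d : ℝ)) * |∑ a, (g (α s (φ a)) - g (φ (σ s a)))|
      ≤ (1 / (d : ℝ)) * ∑ a, (η / 2 + C * ρ (α s (φ a)) (φ (σ s a)) ^ 2) := by
        gcongr
        exact (Finset.abs_sum_le_sum_abs _ _).trans (Finset.sum_le_sum fun a _ => hgC _ _)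
    _ = (1 / (d : ℝ) * d) * (η / 2) +
          C * ((1 / (d : ℝ)) * ∑ a, ρ (α s (φ a)) (φ (σ s a)) ^ 2) := by
        rw [Finset.sum_add_distrib, ← Finset.mul_sum]
        simp
        ring
    _ ≤ 1 * (η / 2) + C * (η / 2 / C) := by gcongr
    _ = η := by field_simp; ring

end Equivariance

section Variational

theorem sum_le_sum_sum_filter {ι κ : Type*} {E : Finset ι} {T : Finset κ} {P : κ → ι → Prop}
    (hP : ∀ i ∈ E, ∃ k ∈ T, P k i) {u : ι → ℝ} (hu : ∀ i, 0 ≤ u i) :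
    ∑ i ∈ E, u i ≤ ∑ k ∈ T, ∑ i ∈ E.filter (P k), u i := by
  simp_rw [Finset.sum_filter]
  rw [Finset.sum_comm]
  refine Finset.sum_le_sum fun i hi => ?_
  obtain ⟨k, hk, hki⟩ := hP i hi
  calc u i = if P k i then u i else 0 := (if_pos hki).symm
    _ ≤ _ := Finset.single_le_sum (f := fun k => if P k i then u i else 0)
        (fun k _ => by split_ifs <;> simp [hu i]) hk

theorem eventually_forall_of_limsup_ite_lt {P : ℕ → Prop} [DecidablePred P] {u : ℕ → ℝ} {t : ℝ}
    (h : limsup (fun i => if P i then ((u i : ℝ) : EReal) else ⊥) atTop < (t : EReal)) :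
    ∀ᶠ i in atTop, P i → u i < t := by
  filter_upwards [eventually_lt_of_limsup_lt h] with i hi hP
  rw [if_pos hP] at hi
  exact_mod_cast hi

theorem limsup_ite_le_of_eventually {P : ℕ → Prop} [DecidablePred P] {u : ℕ → ℝ} {t : ℝ}
    (h : ∀ᶠ i in atTop, P i → u i ≤ t) :
    limsup (fun i => if P i then ((u i : ℝ) : EReal) else ⊥) atTop ≤ (t : EReal) := by
  refine limsup_le_of_le (by isBoundedDefault) ?_
  filter_upwards [h] with i hi
  split_ifs with hP
  · exact_mod_cast hi hP
  · exact bot_le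

variable {G : Type*} [Group G] {X : Type*} {α : G → X → X} {ρ : X → X → ℝ}

theorem MapSet_mono {F F' : Finset G} (hF : F ⊆ F') {δ δ' : ℝ} (hδ : δ' ≤ δ) {d : ℕ}
    (σ : G → Equiv.Perm (Fin d)) : MapSet α ρ F' δ' σ ⊆ MapSet α ρ F δ σ :=
  fun _ hφ s hs => (hφ s (hF hs)).trans_le hδ

variable [MeasurableSpace X]

/-- The empirical measure of a map `φ : Fin d → X`. -/
noncomputable def empiricalMeasure {d : ℕ} (φ : Fin d → X) : Measure X :=
  (d : ENNReal)⁻¹ • ∑ a, Measure.dirac (φ a)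

theorem isProbabilityMeasure_empiricalMeasure {d : ℕ} (hd : 0 < d) (φ : Fin d → X) :
    IsProbabilityMeasure (empiricalMeasure φ) := by
  constructor
  simp only [empiricalMeasure, Measure.smul_apply, Measure.finsetSum_apply, measure_univ,
    Finset.sum_const, Finset.card_univ, Fintype.card_fin, nsmul_eq_mul, mul_one, smul_eq_mul]
  exact ENNReal.inv_mul_cancel (by exact_mod_cast hd.ne') (ENNReal.natCast_ne_top d)

variable [TopologicalSpace X]

theorem integral_empiricalMeasure [OpensMeasurableSpace X] {d : ℕ} (φ : Fin d → X) {g : X → ℝ}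
    (hg : Continuous g) :
    ∫ x, g x ∂(empiricalMeasure φ) = (1 / (d : ℝ)) * ∑ a, g (φ a) := by
  rw [empiricalMeasure, integral_smul_measure, integral_finsetSum_measure]
  · simp [integral_dirac' _ _ hg.stronglyMeasurable]
  · intro a _
    exact integrable_dirac' hg.stronglyMeasurable (by simp)

theorem MapMuSet_mono {μ : Measure X} {F F' : Finset G} (hF : F ⊆ F') {L L' : Finset C(X, ℝ)}
    (hL : L ⊆ L') {δ δ' : ℝ} (hδ : δ' ≤ δ) {d : ℕ} (σ : G → Equiv.Perm (Fin d)) :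
    MapMuSet α μ ρ F' L' δ' σ ⊆ MapMuSet α μ ρ F L δ σ :=
  fun _ hφ => ⟨MapSet_mono hF hδ σ hφ.1, fun g hg => (hφ.2 g (hL hg)).trans_le hδ⟩

variable [CompactSpace X] {d : ℕ → ℕ} {σ : ∀ i, G → Equiv.Perm (Fin (d i))} {f : X → ℝ}

theorem MeasEntropy_add_integral_le_PressureInf (hd : Tendsto d atTop atTop) (hf : Continuous f)
    (hρ : IsContPseudoMetric X ρ) (μ : Measure X) :
    MeasEntropy α μ ρ d σ + ((∫ x, f x ∂μ : ℝ) : EReal) ≤ PressureInf α f ρ d σ := by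
  set c := ∫ x, f x ∂μ with hc
  refine EReal.le_of_forall_lt_iff_le.1 fun t' ht' => ?_
  obtain ⟨t, hPt, htt'⟩ := EReal.lt_iff_exists_real_btwn.1 ht'
  have htt : t < t' := by exact_mod_cast htt'
  suffices h : MeasEntropy α μ ρ d σ ≤ ((t' - c : ℝ) : EReal) by
    refine (add_le_add_left h _).trans (le_of_eq ?_)
    rw [← EReal.coe_add, sub_add_cancel]
  refine iSup₂_le fun ε hε => ?_
  have hε' := (le_iSup₂ (f := fun (ε : ℝ) (_ : 0 < ε) =>
    ⨅ (F : Finset G) (_ : F.Nonempty), ⨅ (δ : ℝ) (_ : 0 < δ),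
    Filter.limsup (fun i =>
      if (MapSet α ρ F δ (σ i)).Nonempty then
        (((Real.log (Mval α f ρ ε F δ (σ i) (rhoInf ρ))) / (d i : ℝ) : ℝ) : EReal)
      else (⊥ : EReal)) atTop) ε hε).trans_lt hPt
  simp only [iInf_lt_iff] at hε'
  obtain ⟨F, hF, δ, hδ, hlim⟩ := hε'
  refine iInf₂_le_of_le F hF (iInf₂_le_of_le {⟨f, hf⟩} (Finset.singleton_nonempty _)
    (iInf₂_le_of_le (min δ (t' - t)) (lt_min hδ (sub_pos.2 htt)) ?_))
  refine limsup_ite_le_of_eventually ?_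
  filter_upwards [eventually_forall_of_limsup_ite_lt hlim, hd.eventually_gt_atTop 0]
    with i hi hdi hne
  have hdi' : (0 : ℝ) < d i := by exact_mod_cast hdi
  have hMne : (MapSet α ρ F δ (σ i)).Nonempty :=
    hne.mono fun φ hφ => MapSet_mono subset_rfl (min_le_left _ _) _ hφ.1
  have hMlt := hi hMne
  have hMpos := Mval_pos hρ hf hε hMne
  have hNpos : 0 < Nval ε (MapMuSet α μ ρ F {⟨f, hf⟩} (min δ (t' - t)) (σ i)) (rhoInf ρ) :=
    one_pos.trans_le (one_le_Nval hρ hε hne)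
  have key : Nval ε (MapMuSet α μ ρ F {⟨f, hf⟩} (min δ (t' - t)) (σ i)) (rhoInf ρ) ≤
      Mval α f ρ ε F δ (σ i) (rhoInf ρ) * Real.exp (-(d i * (c - (t' - t)))) := by
    refine Real.sSup_le ?_ (by positivity)
    rintro _ ⟨E, hEM, hE, rfl⟩
    rw [Real.exp_neg, ← div_eq_mul_inv, le_div_iff₀ (Real.exp_pos _), ← nsmul_eq_mul,
      ← Finset.sum_const]
    refine le_trans (Finset.sum_le_sum fun φ hφ => ?_) (sum_exp_le_Mval hρ hf hε
      (fun φ hφ => MapSet_mono subset_rfl (min_le_left _ _) _ (hEM hφ).1) hE)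
    have h₁ : |1 / (d i : ℝ) * ∑ j, f (φ j) - c| < t' - t :=
      ((hEM hφ).2 _ (Finset.mem_singleton_self _)).trans_le (min_le_right _ _)
    have h₂ := (abs_lt.1 h₁).1
    rw [one_div_mul_eq_div, neg_lt_sub_iff_lt_add, ← sub_lt_iff_lt_add', lt_div_iff₀ hdi'] at h₂
    exact Real.exp_le_exp.2 (by linarith)
  have hlog := Real.log_le_log hNpos key
  rw [Real.log_mul hMpos.ne' (Real.exp_pos _).ne', Real.log_exp] at hlog
  rw [div_lt_iff₀ hdi'] at hMlt
  rw [div_le_iff₀ hdi']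
  linarith

variable [BorelSpace X] [TopologicalSpace.MetrizableSpace X]

/-- Around a measure that is not invariant there are no almost equivariant maps. -/
theorem exists_MapMuSet_eq_empty (hα : ∀ s, Continuous (α s)) (hρ : IsCompatMetric X ρ)
    {μ : Measure X} [IsProbabilityMeasure μ] (hμ : ¬ IsInvProb α μ) :
    ∃ (F : Finset G) (L : Finset C(X, ℝ)) (δ : ℝ), 0 < δ ∧
      ∀ (d : ℕ) (σ : G → Equiv.Perm (Fin d)), MapMuSet α μ ρ F L δ σ = ∅ := by
  obtain ⟨s, hs⟩ : ∃ s, Measure.map (α s) μ ≠ μ := by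
    by_contra! h
    exact hμ ⟨inferInstance, h⟩
  have hmeas : Measurable (α s) := (hα s).measurable
  have : IsProbabilityMeasure (Measure.map (α s) μ) :=
    Measure.isProbabilityMeasure_map hmeas.aemeasurable
  obtain ⟨g, hg⟩ : ∃ g : BoundedContinuousFunction X ℝ,
      ∫ x, g (α s x) ∂μ ≠ ∫ x, g x ∂μ := by
    by_contra! h
    refine hs (ext_of_forall_integral_eq_of_IsFiniteMeasure fun g => ?_)
    rw [integral_map hmeas.aemeasurable g.continuous.aestronglyMeasurable, h]
  set η := |∫ x, g (α s x) ∂μ - ∫ x, g x ∂μ| with hη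
  have hηpos : 0 < η := abs_pos.2 (sub_ne_zero.2 hg)
  obtain ⟨δ, hδ, hgδ⟩ := exists_abs_avg_sub_avg_le α hρ g.continuous s
    (show 0 < η / 4 by positivity)
  refine ⟨{s}, {⟨g, g.continuous⟩, ⟨fun x => g (α s x), g.continuous.comp (hα s)⟩},
    min δ (η / 4), by positivity, fun d σ => Set.eq_empty_of_forall_notMem fun φ hφ => ?_⟩
  have h₁ := hgδ d σ φ (MapSet_mono subset_rfl (min_le_left _ _) _ hφ.1)
  have h₂ := (hφ.2 _ (Finset.mem_insert_self _ _)).trans_le (min_le_right _ _)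
  have h₃ := (hφ.2 _ (Finset.mem_insert_of_mem (Finset.mem_singleton_self _))).trans_le
    (min_le_right _ _)
  simp only [ContinuousMap.coe_mk] at h₂ h₃
  rw [abs_lt] at h₂ h₃
  rw [abs_le] at h₁
  have : η < η := by
    conv_lhs => rw [hη]
    rw [abs_lt]
    constructor <;> linarith
  exact this.false

/-- If the local variational quantity at `μ` is below `t`, then near `μ` the partition function
grows at most like `exp (d t)`. -/
theorem exists_sum_exp_le_of_measure (hα : ∀ s, Continuous (α s)) (hd : Tendsto d atTop atTop)
    (hf : Continuous f) (hρ : IsCompatMetric X ρ) {t : ℝ} {ε : ℝ} (hε : 0 < ε)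
    (ht : ∀ μ : Measure X, IsInvProb α μ →
      MeasEntropy α μ ρ d σ + ((∫ x, f x ∂μ : ℝ) : EReal) < t)
    (μ : Measure X) [IsProbabilityMeasure μ] :
    ∃ (F : Finset G) (L : Finset C(X, ℝ)) (δ : ℝ), 0 < δ ∧ ∀ᶠ i in atTop,
      ∀ E : Finset (Fin (d i) → X), ↑E ⊆ MapMuSet α μ ρ F L δ (σ i) →
        (∀ φ ∈ E, ∀ ψ ∈ E, φ ≠ ψ → ε ≤ rhoInf ρ φ ψ) →
        ∑ φ ∈ E, Real.exp (∑ a, f (φ a)) ≤ Real.exp (d i * t) := by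
  by_cases hμ : IsInvProb α μ
  swap
  · obtain ⟨F, L, δ, hδ, hemp⟩ := exists_MapMuSet_eq_empty hα hρ hμ
    refine ⟨F, L, δ, hδ, Eventually.of_forall fun i E hE _ => ?_⟩
    rw [hemp, Set.subset_empty_iff, Finset.coe_eq_empty] at hE
    simp [hE, Real.exp_nonneg]
  set c := ∫ x, f x ∂μ with hc
  have hlt : MeasEntropy α μ ρ d σ < ((t - c : ℝ) : EReal) := by
    rw [EReal.coe_sub]
    exact EReal.lt_sub_iff_add_lt (by simp) (by simp) |>.2 (ht μ hμ)
  obtain ⟨r, hr, hrt⟩ := EReal.lt_iff_exists_real_btwn.1 hlt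
  have hrt' : r < t - c := by exact_mod_cast hrt
  have hε' := (le_iSup₂ (f := fun (ε : ℝ) (_ : 0 < ε) =>
    ⨅ (F : Finset G) (_ : F.Nonempty),
    ⨅ (L : Finset C(X, ℝ)) (_ : L.Nonempty), ⨅ (δ : ℝ) (_ : 0 < δ),
      Filter.limsup (fun i =>
        if (MapMuSet α μ ρ F L δ (σ i)).Nonempty then
          (((Real.log (Nval ε (MapMuSet α μ ρ F L δ (σ i)) (rhoInf ρ))) / (d i : ℝ) : ℝ) : EReal)
        else (⊥ : EReal)) atTop) ε hε).trans_lt hr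
  simp only [iInf_lt_iff] at hε'
  obtain ⟨F, -, L, -, δ, hδ, hlim⟩ := hε'
  refine ⟨F, insert ⟨f, hf⟩ L, min δ (t - c - r), lt_min hδ (by linarith), ?_⟩
  filter_upwards [eventually_forall_of_limsup_ite_lt hlim, hd.eventually_gt_atTop 0]
    with i hi hdi E hEM hE
  rcases E.eq_empty_or_nonempty with rfl | hEne
  · simp [Real.exp_nonneg]
  have hdi' : (0 : ℝ) < d i := by exact_mod_cast hdi
  have hEM' : ↑E ⊆ MapMuSet α μ ρ F L δ (σ i) :=
    hEM.trans (MapMuSet_mono subset_rfl (Finset.subset_insert _ _) (min_le_left _ _) _)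
  have hne : (MapMuSet α μ ρ F L δ (σ i)).Nonempty := (Finset.coe_nonempty.2 hEne).mono hEM'
  have hNlog := hi hne
  have hNpos := one_pos.trans_le (one_le_Nval hρ.toIsContPseudoMetric hε hne)
  rw [div_lt_iff₀ hdi', Real.log_lt_iff_lt_exp hNpos] at hNlog
  calc ∑ φ ∈ E, Real.exp (∑ a, f (φ a))
      ≤ ∑ _φ ∈ E, Real.exp (d i * (t - r)) := by
        refine Finset.sum_le_sum fun φ hφ => Real.exp_le_exp.2 ?_
        have h₁ : |1 / (d i : ℝ) * ∑ j, f (φ j) - c| < t - c - r :=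
          ((hEM hφ).2 _ (Finset.mem_insert_self _ _)).trans_le (min_le_right _ _)
        have h₂ := (abs_lt.1 h₁).2
        rw [one_div_mul_eq_div, sub_lt_iff_lt_add, div_lt_iff₀ hdi'] at h₂
        linarith
    _ = (E.card : ℝ) * Real.exp (d i * (t - r)) := by simp
    _ ≤ Real.exp (r * d i) * Real.exp (d i * (t - r)) := by
        gcongr
        exact (card_le_Nval hρ.toIsContPseudoMetric hε hEM' hE).trans hNlog.le
    _ = Real.exp (d i * t) := by
        rw [← Real.exp_add]
        ring_nf

theorem PressureInf_le_of_forall_lt (hα : ∀ s, Continuous (α s)) (hd : Tendsto d atTop atTop)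
    (hf : Continuous f) (hρ : IsCompatMetric X ρ) {t t' : ℝ} (htt : t < t')
    (ht : ∀ μ : Measure X, IsInvProb α μ →
      MeasEntropy α μ ρ d σ + ((∫ x, f x ∂μ : ℝ) : EReal) < t) :
    PressureInf α f ρ d σ ≤ t' := by
  refine iSup₂_le fun ε hε => ?_
  choose F L δ hδ hbound using fun μ : ProbabilityMeasure X =>
    exists_sum_exp_le_of_measure hα hd hf hρ hε ht (μ : Measure X)
  let U : ProbabilityMeasure X → Set (ProbabilityMeasure X) := fun μ =>
    {ν | ∀ g ∈ L μ, |∫ x, g x ∂(ν : Measure X) - ∫ x, g x ∂(μ : Measure X)| < δ μ}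
  have hU : ∀ μ, IsOpen (U μ) := fun μ => by
    have : U μ = ⋂ g ∈ L μ,
        {ν : ProbabilityMeasure X |
          |∫ x, g x ∂(ν : Measure X) - ∫ x, g x ∂(μ : Measure X)| < δ μ} := by
      ext ν
      simp [U]
    rw [this]
    refine isOpen_biInter_finset fun g _ => isOpen_lt (continuous_abs.comp ?_) continuous_const
    exact (ProbabilityMeasure.continuous_integral_boundedContinuousFunction
      (BoundedContinuousFunction.mkOfCompact g)).sub continuous_const
  obtain ⟨T, hT⟩ := isCompact_univ.elim_finite_subcover U hU fun μ _ =>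
    Set.mem_iUnion.2 ⟨μ, fun g _ => by simpa using hδ μ⟩
  obtain ⟨δ₀, hδ₀, hδT⟩ : ∃ δ₀ > 0, ∀ μ ∈ T, δ₀ ≤ δ μ := by
    rcases T.eq_empty_or_nonempty with rfl | hTne
    · exact ⟨1, one_pos, by simp⟩
    · obtain ⟨μ, -, hμ⟩ := T.exists_min_image δ hTne
      exact ⟨δ μ, hδ μ, hμ⟩
  refine iInf₂_le_of_le (insert 1 (T.biUnion F)) (Finset.insert_nonempty _ _)
    (iInf₂_le_of_le δ₀ hδ₀ (limsup_ite_le_of_eventually ?_))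
  have hgrow : ∀ᶠ i in atTop, (T.card : ℝ) ≤ Real.exp (d i * (t' - t)) :=
    (Real.tendsto_exp_atTop.comp ((tendsto_natCast_atTop_atTop.comp hd).atTop_mul_const
      (sub_pos.2 htt))).eventually_ge_atTop _
  filter_upwards [hgrow, (Filter.eventually_all_finset T).2 fun μ _ => hbound μ,
    hd.eventually_gt_atTop 0] with i hcard hi hdi hne
  have hdi' : (0 : ℝ) < d i := by exact_mod_cast hdi
  rw [div_le_iff₀ hdi', Real.log_le_iff_le_exp (Mval_pos hρ.toIsContPseudoMetric hf hε hne)]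
  refine Real.sSup_le ?_ (Real.exp_nonneg _)
  rintro _ ⟨E, hEM, hE, rfl⟩
  have hcover : ∀ φ ∈ E, ∃ μ ∈ T, φ ∈ MapMuSet α μ ρ (F μ) (L μ) (δ μ) (σ i) := by
    intro φ hφ
    obtain ⟨μ, hμ, hφμ⟩ := Set.mem_iUnion₂.1 (hT (Set.mem_univ
      (⟨empiricalMeasure φ, isProbabilityMeasure_empiricalMeasure hdi φ⟩ : ProbabilityMeasure X)))
    refine ⟨μ, hμ, MapSet_mono
      ((Finset.subset_biUnion_of_mem F hμ).trans (Finset.subset_insert _ _)) (hδT μ hμ) _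
      (hEM hφ), fun g hg => ?_⟩
    rw [← integral_empiricalMeasure φ g.continuous]
    exact hφμ g hg
  calc ∑ φ ∈ E, Real.exp (∑ a, f (φ a))
      ≤ ∑ μ ∈ T, ∑ φ ∈ E.filter (· ∈ MapMuSet α μ ρ (F μ) (L μ) (δ μ) (σ i)),
          Real.exp (∑ a, f (φ a)) :=
        sum_le_sum_sum_filter hcover fun _ => Real.exp_nonneg _
    _ ≤ ∑ _μ ∈ T, Real.exp (d i * t) := by
        refine Finset.sum_le_sum fun μ hμ => hi μ hμ _ (fun φ hφ => (Finset.mem_filter.1 hφ).2) ?_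
        exact fun φ hφ ψ hψ => hE φ (Finset.mem_filter.1 hφ).1 ψ (Finset.mem_filter.1 hψ).1
    _ = (T.card : ℝ) * Real.exp (d i * t) := by simp
    _ ≤ Real.exp (d i * (t' - t)) * Real.exp (d i * t) := by gcongr
    _ = Real.exp (t' * d i) := by
        rw [← Real.exp_add]
        ring_nf

end Variational

theorem stmt1 {G : Type*} [Group G] [Countable G]
    {X : Type*} [TopologicalSpace X] [CompactSpace X] [TopologicalSpace.MetrizableSpace X]
    [MeasurableSpace X] [BorelSpace X]
    (α : G → X → X) (hα : ContAction G X α)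
    (d : ℕ → ℕ) (σ : ∀ i, G → Equiv.Perm (Fin (d i))) (hσ : IsSoficApprox G d σ)
    (f : X → ℝ) (hf : Continuous f)
    (ρ : X → X → ℝ) (hρ : IsCompatMetric X ρ) :
    (PressureInf α f ρ d σ =
      ⨆ (μ : Measure X) (_ : IsInvProb α μ),
      (MeasEntropy α μ ρ d σ + (((∫ x, f x ∂μ) : ℝ) : EReal))) ∧
    (PressureInf α f ρ d σ ≠ (⊥ : EReal) → ∃ μ : Measure X, IsInvProb α μ) := by
  have heq : PressureInf α f ρ d σ = ⨆ (μ : Measure X) (_ : IsInvProb α μ),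
      (MeasEntropy α μ ρ d σ + (((∫ x, f x ∂μ) : ℝ) : EReal)) := by
    refine le_antisymm (EReal.le_of_forall_lt_iff_le.1 fun t' ht' => ?_)
      (iSup₂_le fun μ _ =>
        MeasEntropy_add_integral_le_PressureInf hσ.dim_top hf hρ.toIsContPseudoMetric μ)
    obtain ⟨t, hlt, htt'⟩ := EReal.lt_iff_exists_real_btwn.1 ht'
    exact PressureInf_le_of_forall_lt hα.cont hσ.dim_top hf hρ (by exact_mod_cast htt')
      fun μ hμ => (le_iSup₂ (f := fun (μ : Measure X) (_ : IsInvProb α μ) =>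
        MeasEntropy α μ ρ d σ + (((∫ x, f x ∂μ) : ℝ) : EReal)) μ hμ).trans_lt hlt
  refine ⟨heq, fun hne => ?_⟩
  by_contra! h
  exact hne (heq.trans (by simp [h]))

end Sofic
end

section
/- Let G be a countable amenable group acting continuously on a compact metrizable space X, let Σ be a sofic approximation sequence for G, and let f : X → ℝ be continuous. Then for every compatible metric ρ on X and every Følner sequence {F_n} of G, P_Σ(f,X,G) ≤ sup_{ε>0} limsup_{n→∞} (1/|F_n|) log K_ε(f,X,G,ρ,F_n); that is, the sofic topological pressure is at most the classical topological pressure P(f,X,G). -/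
open Filter MeasureTheory
open scoped Pointwise Classical BigOperators

namespace Sofic

/-- Hölder's inequality for finitely many nonnegative functions on a finite type. -/
theorem sum_prod_rpow_le_prod_sum_rpow {J L : Type*} [Fintype L] (S : Finset J) (p : J → ℝ)
    (hp : ∀ j, 0 ≤ p j) (hS : ∑ j ∈ S, p j = 1) (h : J → L → ℝ) (hh : ∀ j l, 0 ≤ h j l) :
    ∑ l, ∏ j ∈ S, h j l ^ p j ≤ ∏ j ∈ S, (∑ l, h j l) ^ p j := by
  have hH : ∀ j, 0 ≤ ∑ l, h j l := fun j => Finset.sum_nonneg fun l _ => hh j l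
  by_cases hz : ∃ j ∈ S, (∑ l, h j l) = 0 ∧ p j ≠ 0
  · obtain ⟨j, hj, h0, hpj⟩ := hz
    have hl : ∀ l, h j l = 0 := fun l =>
      (Finset.sum_eq_zero_iff_of_nonneg fun l _ => hh j l).1 h0 l (Finset.mem_univ l)
    calc ∑ l, ∏ j ∈ S, h j l ^ p j = 0 := Finset.sum_eq_zero fun l _ =>
          Finset.prod_eq_zero hj (by rw [hl, Real.zero_rpow hpj])
      _ ≤ _ := Finset.prod_nonneg fun j _ => Real.rpow_nonneg (hH j) _
  · push Not at hz
    have key : ∀ l, ∏ j ∈ S, h j l ^ p j ≤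
        (∑ j ∈ S, p j * (h j l / ∑ l, h j l)) * ∏ j ∈ S, (∑ l, h j l) ^ p j := by
      intro l
      have e : ∏ j ∈ S, h j l ^ p j =
          (∏ j ∈ S, (h j l / ∑ l, h j l) ^ p j) * ∏ j ∈ S, (∑ l, h j l) ^ p j := by
        rw [← Finset.prod_mul_distrib]
        refine Finset.prod_congr rfl fun j hj => ?_
        by_cases h0 : (∑ l, h j l) = 0
        · simp [hz j hj h0]
        · rw [← Real.mul_rpow (div_nonneg (hh j l) (hH j)) (hH j), div_mul_cancel₀ _ h0]
      rw [e]
      exact mul_le_mul_of_nonneg_right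
        (Real.geom_mean_le_arith_mean_weighted S p _ (fun j _ => hp j) hS
          fun j _ => div_nonneg (hh j l) (hH j))
        (Finset.prod_nonneg fun j _ => Real.rpow_nonneg (hH j) _)
    refine (Finset.sum_le_sum fun l _ => key l).trans ?_
    rw [← Finset.sum_mul, Finset.sum_comm]
    refine mul_le_of_le_one_left (Finset.prod_nonneg fun j _ => Real.rpow_nonneg (hH j) _) ?_
    rw [← hS]
    refine Finset.sum_le_sum fun j _ => ?_
    rw [← Finset.mul_sum, ← Finset.sum_div]
    exact mul_le_of_le_one_right (hp j) (div_self_le_one _)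

/-- A fractional form of Shearer's (Finner's) inequality for sums of product functions. -/
theorem sum_prod_rpow_le_of_fractional_cover {J L κ : Type*} [Fintype J] [Fintype L]
    (p : J → ℝ) (hp : ∀ j, 0 ≤ p j) (D : J → Finset κ) :
    ∀ (n : ℕ) (T : J → Fin n → Prop) (_ : ∀ i, ∑ j with T j i, p j = 1)
      (A : J → κ → ℝ) (_ : ∀ j x, 0 ≤ A j x) (u : J → κ → Fin n → L → ℝ)
      (_ : ∀ j x i l, 0 ≤ u j x i l),
      ∑ y : Fin n → L, ∏ j, (∑ x ∈ D j, A j x * ∏ i, if T j i then u j x i (y i) else 1) ^ p j ≤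
        ∏ j, (∑ x ∈ D j, A j x * ∏ i, if T j i then ∑ l, u j x i l else 1) ^ p j := by
  intro n
  induction n with
  | zero => intro T hT A hA u hu; simp
  | succ n ih =>
    intro T hT A hA u hu
    have hA' : ∀ j x, 0 ≤ A j x * if T j 0 then ∑ l, u j x 0 l else 1 := fun j x =>
      mul_nonneg (hA j x) (by split_ifs; exacts [Finset.sum_nonneg fun l _ => hu _ _ _ _, zero_le_one])
    have := ih (fun j i => T j i.succ) (fun i => hT i.succ)
      (fun j x => A j x * if T j 0 then ∑ l, u j x 0 l else 1) hA'
      (fun j x i l => u j x i.succ l) (fun j x i l => hu _ _ _ _)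
    simp only [Fin.prod_univ_succ, ← mul_assoc]
    refine le_trans ?_ this
    rw [← (Fin.consEquiv fun _ : Fin (n + 1) => L).sum_comp, Fintype.sum_prod_type_right]
    refine Finset.sum_le_sum fun y _ => ?_
    simp only [Fin.consEquiv_apply, Fin.cons_zero, Fin.cons_succ]
    set R : J → κ → ℝ := fun j x => ∏ i : Fin n, if T j i.succ then u j x i.succ (y i) else 1 with hR
    have hR0 : ∀ j x, 0 ≤ R j x := fun j x => Finset.prod_nonneg fun i _ => by
      split_ifs; exacts [hu _ _ _ _, zero_le_one]
    have hh : ∀ j l, 0 ≤ ∑ x ∈ D j, A j x * u j x 0 l * R j x := fun j l =>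
      Finset.sum_nonneg fun x _ => mul_nonneg (mul_nonneg (hA _ _) (hu _ _ _ _)) (hR0 _ _)
    have hc : ∀ j, 0 ≤ (∑ x ∈ D j, A j x * R j x) ^ p j := fun j => Real.rpow_nonneg
      (Finset.sum_nonneg fun x _ => mul_nonneg (hA _ _) (hR0 _ _)) _
    have split : ∀ F : J → ℝ, ∏ j, F j =
        (∏ j with T j 0, F j) * ∏ j with ¬ T j 0, F j := fun F =>
      (Finset.prod_filter_mul_prod_filter_not _ _ _).symm
    have e1 : ∀ l, ∏ j, (∑ x ∈ D j, (A j x * if T j 0 then u j x 0 l else 1) * R j x) ^ p j =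
        (∏ j with T j 0, (∑ x ∈ D j, A j x * u j x 0 l * R j x) ^ p j) *
          ∏ j with ¬ T j 0, (∑ x ∈ D j, A j x * R j x) ^ p j := by
      intro l
      rw [split]
      congr 1 <;> refine Finset.prod_congr rfl fun j hj => ?_ <;>
        simp [(Finset.mem_filter.1 hj).2]
    have e2 : ∏ j, (∑ x ∈ D j, (A j x * if T j 0 then ∑ l, u j x 0 l else 1) * R j x) ^ p j =
        (∏ j with T j 0, (∑ l, ∑ x ∈ D j, A j x * u j x 0 l * R j x) ^ p j) *
          ∏ j with ¬ T j 0, (∑ x ∈ D j, A j x * R j x) ^ p j := by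
      rw [split]
      congr 1 <;> refine Finset.prod_congr rfl fun j hj => ?_
      · simp only [(Finset.mem_filter.1 hj).2, if_true]
        rw [Finset.sum_comm]
        simp only [Finset.mul_sum, Finset.sum_mul]
      · simp [(Finset.mem_filter.1 hj).2]
    rw [e2, Finset.sum_congr rfl fun l _ => e1 l, ← Finset.sum_mul]
    exact mul_le_mul_of_nonneg_right
      (sum_prod_rpow_le_prod_sum_rpow _ p hp (hT 0) _ hh) (Finset.prod_nonneg fun j _ => hc j)

theorem IsCompatMetric.exists_abs_sub_lt {X : Type*} [TopologicalSpace X] [CompactSpace X]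
    {ρ : X → X → ℝ} (hρ : IsCompatMetric X ρ) {f : X → ℝ} (hf : Continuous f) {κ : ℝ}
    (hκ : 0 < κ) : ∃ r > 0, ∀ x y, ρ x y < r → |f x - f y| < κ := by
  have hK : IsCompact {q : X × X | κ ≤ |f q.1 - f q.2|} :=
    (isClosed_le continuous_const (by fun_prop)).isCompact
  rcases Set.eq_empty_or_nonempty {q : X × X | κ ≤ |f q.1 - f q.2|} with h | h
  · refine ⟨1, one_pos, fun x y _ => ?_⟩
    by_contra! hxy
    exact (Set.ext_iff.1 h (x, y)).1 hxy
  · obtain ⟨q, hq, hmin⟩ := hK.exists_isMinOn h hρ.cont.continuousOn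
    refine ⟨ρ q.1 q.2, lt_of_le_of_ne (hρ.nonneg _ _) fun h0 => ?_, fun x y hxy => ?_⟩
    · have : q.1 = q.2 := hρ.eq_of_zero _ _ h0.symm
      have hq' : κ ≤ |f q.1 - f q.2| := hq
      rw [this, sub_self, abs_zero] at hq'
      linarith
    · by_contra! hc
      exact absurd (hmin (show (x, y) ∈ {q : X × X | κ ≤ |f q.1 - f q.2|} from hc))
        (not_le.2 hxy)

theorem IsContPseudoMetric.exists_finite_net {X : Type*} [TopologicalSpace X] [CompactSpace X]
    {ρ : X → X → ℝ} (hρ : IsContPseudoMetric X ρ) {r : ℝ} (hr : 0 < r) :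
    ∃ (N : ℕ) (z : Fin N → X), ∀ x, ∃ j, ρ x (z j) < r := by
  obtain ⟨t, ht⟩ := CompactSpace.elim_nhds_subcover (fun x => {y | ρ y x < r}) fun x =>
    (isOpen_lt (hρ.cont.comp (Continuous.prodMk continuous_id continuous_const))
      continuous_const).mem_nhds (by simpa [hρ.refl] using hr)
  refine ⟨t.card, fun j => (t.equivFin.symm j : X), fun x => ?_⟩
  have hx : x ∈ ⋃ y ∈ t, {y' | ρ y' y < r} := ht ▸ Set.mem_univ x
  simp only [Set.mem_iUnion, Set.mem_ofPred_eq] at hx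
  obtain ⟨y, hy, hxy⟩ := hx
  exact ⟨t.equivFin ⟨y, hy⟩, by simpa using hxy⟩

/-- Finite codings of a compact space by cells of small diameter, with the family of codings so
rich that every finite sequence of points mostly avoids the cell boundaries of one of them. -/
theorem IsCompatMetric.exists_coding {X : Type*} [TopologicalSpace X] [CompactSpace X] [Nonempty X]
    {ρ : X → X → ℝ} (hρ : IsCompatMetric X ρ) {f : X → ℝ} (hf : Continuous f) {ε κ : ℝ}
    (hε : 0 < ε) (hκ : 0 < κ) :
    ∃ (N : ℕ) (rep : Finset (Fin N) → X), ∀ η > 0,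
      ∃ (M : ℕ) (lab : Fin M → X → Finset (Fin N)) (θ : ℝ), 0 < θ ∧
        (∀ t x, ρ x (rep (lab t x)) < ε / 2 ∧ |f x - f (rep (lab t x))| < κ) ∧
        ∀ (d : ℕ) (φ : Fin d → X), ∃ t,
          ((Finset.univ.filter fun a => ∃ x', ρ (φ a) x' < θ ∧ lab t x' ≠ lab t (φ a)).card : ℝ)
            ≤ η * d := by
  obtain ⟨r₀, hr₀, hosc⟩ := hρ.exists_abs_sub_lt hf hκ
  set r : ℝ := min (ε / 2) r₀ / 2 with hr
  have hrpos : 0 < r := by positivity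
  obtain ⟨N, z, hz⟩ := hρ.toIsContPseudoMetric.exists_finite_net hrpos
  refine ⟨N, fun S => if h : ∃ j, j ∈ S then z h.choose else Classical.arbitrary X, fun η hη => ?_⟩
  obtain ⟨M, hM⟩ := exists_nat_ge (max 1 (N / η))
  have hM1 : (1 : ℝ) ≤ M := (le_max_left _ _).trans hM
  have hMN : (N : ℝ) ≤ η * M := by
    have := (le_max_right _ _).trans hM
    rw [div_le_iff₀ hη] at this; linarith
  have hMpos : 0 < M := by exact_mod_cast (zero_lt_one.trans_le hM1)
  have hM0 : (0 : ℝ) < M := by exact_mod_cast hMpos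
  set R : Fin M → ℝ := fun t => r + r * (t : ℕ) / M with hR
  have hRle : ∀ t, r ≤ R t := fun t => by
    have : 0 ≤ r * (t : ℕ) / M := by positivity
    simp only [hR]; linarith
  have hRlt : ∀ t, R t < min (ε / 2) r₀ := fun t => by
    have : ((t : ℕ) : ℝ) < M := by exact_mod_cast t.2
    have : r * (t : ℕ) / M < r := by
      rw [div_lt_iff₀ hM0]; exact mul_lt_mul_of_pos_left this hrpos
    simp only [hR]; linarith
  have hsep : ∀ t t' : Fin M, t ≠ t' → r / M ≤ |R t - R t'| := by
    intro t t' htt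
    have h1 : (1 : ℝ) ≤ |((t : ℕ) : ℝ) - ((t' : ℕ) : ℝ)| := by
      have : ((t : ℕ) : ℤ) - ((t' : ℕ) : ℤ) ≠ 0 := by
        intro h; apply htt; ext; omega
      exact_mod_cast Int.one_le_abs this
    have e : R t - R t' = r / M * (((t : ℕ) : ℝ) - ((t' : ℕ) : ℝ)) := by
      simp only [hR]; ring
    rw [e, abs_mul, abs_of_pos (by positivity : 0 < r / M)]
    exact le_mul_of_one_le_right (by positivity) h1
  obtain ⟨θ, hθ, hθM⟩ : ∃ θ > 0, r / (M : ℝ) = θ + θ :=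
    ⟨r / (M : ℝ) / 2, by positivity, by ring⟩
  refine ⟨M, fun t x => Finset.univ.filter fun j => ρ x (z j) < R t, θ, hθ,
    fun t x => ?_, fun d φ => ?_⟩
  · obtain ⟨j, hj⟩ := hz x
    have hne : ∃ j, j ∈ Finset.univ.filter fun j => ρ x (z j) < R t :=
      ⟨j, by simpa using hj.trans_le (hRle t)⟩
    beta_reduce
    rw [dif_pos hne]
    have hc := (Finset.mem_filter.1 hne.choose_spec).2
    have hc' := hc.trans (hRlt t)
    exact ⟨hc'.trans_le (min_le_left _ _), hosc _ _ (hc'.trans_le (min_le_right _ _))⟩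
  · set b : Fin M → Finset (Fin d) := fun t => Finset.univ.filter fun a =>
      ∃ j, |ρ (φ a) (z j) - R t| < θ with hb
    have hsum : ∑ t, ((b t).card : ℝ) ≤ ∑ _t : Fin M, η * d := by
      have hcard : ∀ t, ((b t).card : ℝ) ≤
          ∑ a, ∑ j, if |ρ (φ a) (z j) - R t| < θ then (1 : ℝ) else 0 := by
        intro t
        rw [Finset.card_filter, Nat.cast_sum]
        refine Finset.sum_le_sum fun a _ => ?_
        have hnn : ∀ j ∈ Finset.univ, (0 : ℝ) ≤
            if |ρ (φ a) (z j) - R t| < θ then (1 : ℝ) else 0 := fun j _ => by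
          split_ifs <;> norm_num
        by_cases h : ∃ j, |ρ (φ a) (z j) - R t| < θ
        · obtain ⟨j, hj⟩ := h
          refine le_trans ?_ (Finset.single_le_sum hnn (Finset.mem_univ j))
          rw [if_pos ⟨j, hj⟩, if_pos hj, Nat.cast_one]
        · rw [if_neg h, Nat.cast_zero]; exact Finset.sum_nonneg hnn
      have hone : ∀ a j, ∑ t : Fin M,
          (if |ρ (φ a) (z j) - R t| < θ then (1 : ℝ) else 0) ≤ 1 := by
        intro a j
        rw [Finset.sum_boole]
        norm_cast
        rw [Finset.card_le_one]
        intro t ht t' ht'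
        by_contra hne
        have h1 := (Finset.mem_filter.1 ht).2
        have h2 := (Finset.mem_filter.1 ht').2
        have h3 := hsep t t' hne
        rw [abs_sub_comm] at h1
        have := abs_add_le (R t - ρ (φ a) (z j)) (ρ (φ a) (z j) - R t')
        rw [sub_add_sub_cancel] at this
        linarith
      calc ∑ t, ((b t).card : ℝ)
          ≤ ∑ t, ∑ a, ∑ j, if |ρ (φ a) (z j) - R t| < θ then (1 : ℝ) else 0 :=
            Finset.sum_le_sum fun t _ => hcard t
        _ = ∑ a, ∑ j, ∑ t, if |ρ (φ a) (z j) - R t| < θ then (1 : ℝ) else 0 := by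
            rw [Finset.sum_comm]
            exact Finset.sum_congr rfl fun a _ => Finset.sum_comm
        _ ≤ ∑ _a : Fin d, ∑ _j : Fin N, (1 : ℝ) :=
            Finset.sum_le_sum fun a _ => Finset.sum_le_sum fun j _ => hone a j
        _ = d * N := by simp
        _ ≤ d * (η * M) := by gcongr
        _ = _ := by simp; ring
    obtain ⟨t, -, ht⟩ := Finset.exists_le_of_sum_le ⟨⟨0, hMpos⟩, Finset.mem_univ _⟩ hsum
    refine ⟨t, le_trans ?_ ht⟩
    norm_cast
    refine Finset.card_le_card fun a ha => ?_
    obtain ⟨x', hx', hne⟩ := (Finset.mem_filter.1 ha).2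
    refine Finset.mem_filter.2 ⟨Finset.mem_univ _, ?_⟩
    by_contra! hfar
    refine hne (Finset.filter_congr fun j _ => ?_)
    have h1 := hρ.triangle (φ a) x' (z j)
    have h2 := hρ.triangle x' (φ a) (z j)
    rw [hρ.symm x' (φ a)] at h2
    rcases le_abs.1 (hfar j) with h | h
    · constructor <;> intro <;> linarith
    · constructor <;> intro <;> linarith

theorem bddAbove_range_biSup {G : Type*} (F : Finset G) {g : G → ℝ} (hg : ∀ s, 0 ≤ g s) :
    BddAbove (Set.range fun s => ⨆ _ : s ∈ F, g s) := by
  refine ⟨∑ s ∈ F, g s, ?_⟩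
  rintro _ ⟨s, rfl⟩
  exact Real.iSup_le (fun hs => Finset.single_le_sum (fun s _ => hg s) hs)
    (Finset.sum_nonneg fun s _ => hg s)

theorem le_biSup_finset {G : Type*} (F : Finset G) {g : G → ℝ} (hg : ∀ s, 0 ≤ g s) {s : G}
    (hs : s ∈ F) : g s ≤ ⨆ s ∈ F, g s := by
  have h := le_ciSup (bddAbove_range_biSup F hg) s
  rwa [ciSup_pos hs] at h

theorem ContAction.isContPseudoMetric_sum {G : Type*} [Group G] {X : Type*} [TopologicalSpace X]
    {α : G → X → X} (hα : ContAction G X α) {ρ : X → X → ℝ} (hρ : IsContPseudoMetric X ρ)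
    (F : Finset G) : IsContPseudoMetric X fun x y => ∑ s ∈ F, ρ (α s x) (α s y) where
  nonneg _ _ := Finset.sum_nonneg fun _ _ => hρ.nonneg _ _
  refl _ := Finset.sum_eq_zero fun _ _ => hρ.refl _
  symm _ _ := Finset.sum_congr rfl fun _ _ => hρ.symm _ _
  triangle _ _ _ := by
    rw [← Finset.sum_add_distrib]
    exact Finset.sum_le_sum fun _ _ => hρ.triangle _ _ _
  cont := continuous_finsetSum _ fun s _ => hρ.cont.comp
    (((hα.cont s).comp continuous_fst).prodMk ((hα.cont s).comp continuous_snd))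

/-- Separated sets in the dynamical metric have uniformly bounded cardinality. -/
theorem ContAction.exists_card_le {G : Type*} [Group G] {X : Type*} [TopologicalSpace X]
    [CompactSpace X] {α : G → X → X} (hα : ContAction G X α) {ρ : X → X → ℝ}
    (hρ : IsContPseudoMetric X ρ) (F : Finset G) {θ : ℝ} (hθ : 0 < θ) :
    ∃ N : ℕ, ∀ D : Finset X,
      (∀ x ∈ D, ∀ y ∈ D, x ≠ y → θ ≤ ⨆ s ∈ F, ρ (α s x) (α s y)) → D.card ≤ N := by
  have hS := hα.isContPseudoMetric_sum hρ F
  obtain ⟨N, z, hz⟩ := hS.exists_finite_net (by positivity : 0 < θ / 3)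
  choose j hj using hz
  refine ⟨N, fun D hD => ?_⟩
  have h := Finset.card_le_card_of_injOn j (s := D) (t := Finset.univ)
    (fun _ _ => Finset.mem_univ _) ?_
  · simpa using h
  intro x hx y hy hxy
  by_contra hne
  have h1 := hD x hx y hy hne
  have h2 := hS.triangle x (z (j x)) y
  have h3 := hj x
  have h4 := hj y
  rw [hS.symm, ← hxy] at h4
  have h5 : ⨆ s ∈ F, ρ (α s x) (α s y) ≤ ∑ s ∈ F, ρ (α s x) (α s y) :=
    Real.iSup_le (fun s => Real.iSup_le (fun hs => Finset.single_le_sum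
      (f := fun s => ρ (α s x) (α s y)) (fun s _ => hρ.nonneg _ _) hs)
      (hS.nonneg x y)) (hS.nonneg x y)
  linarith

/-- There is a finite spanning set whose weight is at most `Kval`. -/
theorem ContAction.exists_spanning {G : Type*} [Group G] {X : Type*} [TopologicalSpace X]
    [CompactSpace X] {α : G → X → X} (hα : ContAction G X α) {ρ : X → X → ℝ}
    (hρ : IsContPseudoMetric X ρ) {f : X → ℝ} {C : ℝ} (hC : ∀ x, |f x| ≤ C)
    (F : Finset G) {θ : ℝ} (hθ : 0 < θ) :
    ∃ D : Finset X, (∀ x, ∃ y ∈ D, ∀ s ∈ F, ρ (α s x) (α s y) < θ) ∧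
      ∑ x ∈ D, Real.exp (∑ s ∈ F, f (α s x)) ≤ Kval α f ρ θ F := by
  obtain ⟨N, hN⟩ := hα.exists_card_le hρ F hθ
  set A : Set ℕ := {n | ∃ D : Finset X,
    (∀ x ∈ D, ∀ y ∈ D, x ≠ y → θ ≤ ⨆ s ∈ F, ρ (α s x) (α s y)) ∧ D.card = n} with hA
  have hAbdd : BddAbove A := by
    refine ⟨N, ?_⟩
    rintro _ ⟨D, hD, rfl⟩
    exact hN D hD
  obtain ⟨D, hD, hcard⟩ : sSup A ∈ A := Nat.sSup_mem ⟨0, ∅, by simp, rfl⟩ hAbdd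
  refine ⟨D, fun x => ?_, ?_⟩
  · by_contra! hx
    have hfar : ∀ y ∈ D, θ ≤ ⨆ s ∈ F, ρ (α s x) (α s y) := fun y hy => by
      obtain ⟨s, hs, h⟩ := hx y hy
      exact h.trans (le_biSup_finset F (g := fun s => ρ (α s x) (α s y))
        (fun s => hρ.nonneg _ _) hs)
    have hxD : x ∉ D := fun hxD => by
      obtain ⟨s, hs, h⟩ := hx x hxD
      rw [hρ.refl] at h
      linarith
    have hmem : (insert x D).card ∈ A := by
      refine ⟨_, fun y hy y' hy' hne => ?_, rfl⟩
      rcases Finset.mem_insert.1 hy with rfl | hyD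
      · rcases Finset.mem_insert.1 hy' with rfl | hyD'
        · exact absurd rfl hne
        · exact hfar _ hyD'
      · rcases Finset.mem_insert.1 hy' with rfl | hyD'
        · simp only [fun s => hρ.symm (α s y) (α s y')]
          exact hfar _ hyD
        · exact hD _ hyD _ hyD' hne
    have := le_csSup hAbdd hmem
    rw [Finset.card_insert_of_notMem hxD] at this
    omega
  · refine le_csSup ⟨N * Real.exp (F.card * C), ?_⟩ ⟨D, hD, rfl⟩
    rintro _ ⟨D', hD', rfl⟩
    calc ∑ x ∈ D', Real.exp (∑ s ∈ F, f (α s x))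
        ≤ ∑ x ∈ D', Real.exp (F.card * C) := by
          refine Finset.sum_le_sum fun x _ => Real.exp_le_exp.2 ?_
          rw [← nsmul_eq_mul]
          exact Finset.sum_le_card_nsmul _ _ _ fun s _ => (le_abs_self _).trans (hC _)
      _ = D'.card * Real.exp (F.card * C) := by simp
      _ ≤ N * Real.exp (F.card * C) := by
          gcongr
          exact_mod_cast hN D' hD'

theorem prod_rpow_prod_ite {J ι : Type*} [Fintype J] [Fintype ι] (p : J → ℝ) (T : J → ι → Prop)
    (hT : ∀ i, ∑ j with T j i, p j = 1) (v : ι → ℝ) (hv : ∀ i, 0 < v i) :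
    ∏ j, (∏ i, if T j i then v i else 1) ^ p j = ∏ i, v i := by
  have e : ∀ j, (∏ i, if T j i then v i else 1) ^ p j =
      ∏ i, v i ^ (if T j i then p j else 0) := fun j => by
    rw [← Real.finsetProd_rpow _ _ fun i _ => by split_ifs; exacts [(hv i).le, zero_le_one]]
    refine Finset.prod_congr rfl fun i _ => ?_
    split_ifs <;> simp
  rw [Finset.prod_congr rfl fun j _ => e j, Finset.prod_comm]
  refine Finset.prod_congr rfl fun i _ => ?_
  rw [← Real.rpow_sum_of_pos (hv i), ← Finset.sum_filter, hT, Real.rpow_one]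

/-- The counting estimate for labelled maps whose restrictions to most of the sets `σ(F)c` are
determined, off `B`, by a point of `D`. -/
theorem sum_exp_le_of_labelling {G X L : Type*} [Fintype L] {d : ℕ}
    (σ : G → Equiv.Perm (Fin d)) (α : G → X → X) {f : X → ℝ} {C κ ω q : ℝ}
    (hC : ∀ x, |f x| ≤ C) (hκ : 0 ≤ κ) (rep : L → X) (lab : X → L)
    (hrep : ∀ x, |f x - f (rep (lab x))| ≤ κ) {F : Finset G} (hF : F.Nonempty) (D : Finset X)
    (B Z : Finset (Fin d)) (E : Finset (Fin d → X))
    (hinj : ∀ φ ∈ E, ∀ ψ ∈ E, (∀ a, lab (φ a) = lab (ψ a)) → φ = ψ)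
    (hgood : ∀ φ ∈ E, ∀ c ∉ Z, ∃ x ∈ D, ∀ s ∈ F, σ s c ∉ B → lab (α s x) = lab (φ (σ s c)))
    (hZ : ∀ c ∉ Z, Set.InjOn (fun s => σ s c) F)
    (hq : ∑ x ∈ D, Real.exp (∑ s ∈ F, f (α s x)) ≤ Real.exp q) (hqC : -(C * F.card) ≤ q)
    (hω : 0 ≤ ω) (hL : Fintype.card L * Real.exp (2 * C) ≤ Real.exp ω) (x₀ : X) :
    ∑ φ ∈ E, Real.exp (∑ a, f (φ a)) ≤
      Real.exp (2 * κ * d + q / F.card * d + ω * (B.card + Z.card) + C * Z.card) := by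
  have hk0 : 0 < F.card := hF.card_pos
  have hk : (0 : ℝ) < F.card := by exact_mod_cast hk0
  set w : L → ℝ := fun l => Real.exp (f (rep l)) with hw
  have hwpos : ∀ l, 0 < w l := fun l => Real.exp_pos _
  set r : Fin d → ℝ := fun c => if c ∈ Z then 0 else 1 / (F.card : ℝ) with hr
  have hr0 : ∀ c, 0 ≤ r c := fun c => by simp only [hr]; split_ifs <;> positivity
  have hrle : ∀ c, r c ≤ 1 / F.card := fun c => by
    simp only [hr]; split_ifs
    · positivity
    · exact le_rfl
  set P : Fin d → Fin d → Prop := fun c i => ∃ s ∈ F, σ s c = i with hP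
  set S : Fin d → ℝ := fun i => ∑ c, if P c i then r c else 0 with hS
  have hS1 : ∀ i, S i ≤ 1 := fun i => by
    have h1 : S i ≤ ∑ c with P c i, 1 / (F.card : ℝ) := by
      rw [Finset.sum_filter]
      refine Finset.sum_le_sum fun c _ => ?_
      split_ifs
      exacts [hrle c, le_rfl]
    have h2 : (Finset.univ.filter fun c => P c i).card ≤ F.card := by
      refine (Finset.card_le_card (t := F.image fun s => (σ s).symm i) fun c hc => ?_).trans
        Finset.card_image_le
      obtain ⟨s, hs, h⟩ := (Finset.mem_filter.1 hc).2
      exact Finset.mem_image.2 ⟨s, hs, by rw [← h, Equiv.symm_apply_apply]⟩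
    refine h1.trans ?_
    rw [Finset.sum_const, nsmul_eq_mul, mul_one_div, div_le_one hk]
    exact_mod_cast h2
  have hSsum : ∑ i, S i = ∑ c, r c * F.card := by
    simp only [hS]
    rw [Finset.sum_comm]
    refine Finset.sum_congr rfl fun c _ => ?_
    rw [← Finset.sum_filter, Finset.sum_const, nsmul_eq_mul, mul_comm]
    by_cases hc : c ∈ Z
    · simp [hr, hc]
    · congr 2
      rw [← Finset.card_image_of_injOn (hZ c hc)]
      congr 1
      ext i
      simp [hP]
  have hrsum : ∑ c, r c * F.card = d - Z.card := by
    have e : ∀ c, r c * F.card = 1 - if c ∈ Z then (1 : ℝ) else 0 := fun c => by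
      simp only [hr]; split_ifs
      · simp
      · field_simp; ring
    simp [e]
  set J := Fin d ⊕ Fin d with hJ
  set p : J → ℝ := Sum.elim r (fun a => 1 - S a) with hp
  set T : J → Fin d → Prop := Sum.elim P (fun a i => i = a) with hTdef
  have hp0 : ∀ j, 0 ≤ p j := by
    rintro (c | a)
    · exact hr0 c
    · exact sub_nonneg.2 (hS1 a)
  have hT : ∀ i, ∑ j with T j i, p j = 1 := fun i => by
    rw [Finset.sum_filter, Fintype.sum_sum_type]
    simp only [hp, hTdef, Sum.elim_inl, Sum.elim_inr, Finset.sum_ite_eq, Finset.mem_univ, if_true]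
    exact add_sub_cancel (S i) 1
  set DD : J → Finset X := Sum.elim (fun _ => D) (fun _ => {x₀}) with hDD
  set u : J → X → Fin d → L → ℝ := Sum.elim
    (fun c x i l => if i ∈ B then w l else if ∃ s ∈ F, σ s c = i ∧ lab (α s x) = l then w l else 0)
    (fun _ _ _ l => w l) with hu
  have hu0 : ∀ j x i l, 0 ≤ u j x i l := by
    rintro (c | a) x i l
    · simp only [hu, Sum.elim_inl]
      split_ifs
      exacts [(hwpos l).le, (hwpos l).le, le_rfl]
    · exact (hwpos l).le
  have finner := sum_prod_rpow_le_of_fractional_cover p hp0 DD d T hT (fun _ _ => 1)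
    (fun _ _ => zero_le_one) u hu0
  simp only [one_mul] at finner
  set g : (Fin d → L) → ℝ := fun y =>
    ∏ j, (∑ x ∈ DD j, ∏ i, if T j i then u j x i (y i) else 1) ^ p j with hg
  have hprodu : ∀ j x (y : Fin d → L), 0 ≤ ∏ i, if T j i then u j x i (y i) else 1 :=
    fun j x y => Finset.prod_nonneg fun i _ => by
      split_ifs; exacts [hu0 _ _ _ _, zero_le_one]
  have hg0 : ∀ y, 0 ≤ g y := fun y => Finset.prod_nonneg fun j _ =>
    Real.rpow_nonneg (Finset.sum_nonneg fun x _ => hprodu j x y) _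
  have hlower : ∀ φ ∈ E, Real.exp (∑ a, f (φ a)) ≤ Real.exp (κ * d) * g fun a => lab (φ a) := by
    intro φ hφ
    have h1 : Real.exp (∑ a, f (φ a)) ≤ Real.exp (κ * d) * ∏ a, w (lab (φ a)) := by
      rw [← Real.exp_sum, ← Real.exp_add]
      refine Real.exp_le_exp.2 ?_
      have : κ * d = ∑ _a : Fin d, κ := by simp [mul_comm]
      rw [this, ← Finset.sum_add_distrib]
      refine Finset.sum_le_sum fun a _ => ?_
      have := (abs_le.1 (hrep (φ a))).2
      linarith
    refine h1.trans (mul_le_mul_of_nonneg_left ?_ (Real.exp_pos _).le)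
    rw [← prod_rpow_prod_ite p T hT _ fun i => hwpos _]
    have htile : ∀ j, 0 < ∏ i, if T j i then w (lab (φ i)) else 1 := fun j =>
      Finset.prod_pos fun i _ => by split_ifs; exacts [hwpos _, zero_lt_one]
    refine Finset.prod_le_prod (fun j _ => Real.rpow_nonneg (htile j).le _) ?_
    rintro (c | a) -
    · by_cases hc : c ∈ Z
      · simp [hp, hr, hc]
      · refine Real.rpow_le_rpow (htile _).le ?_ (hp0 _)
        obtain ⟨x, hx, hxs⟩ := hgood φ hφ c hc
        refine le_trans (le_of_eq ?_) (Finset.single_le_sum (fun x _ => hprodu (Sum.inl c) x _)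
          (show x ∈ DD (Sum.inl c) from hx))
        refine Finset.prod_congr rfl fun i _ => ?_
        by_cases hi : T (Sum.inl c) i
        · rw [if_pos hi, if_pos hi]
          simp only [hu, Sum.elim_inl]
          by_cases hiB : i ∈ B
          · rw [if_pos hiB]
          · obtain ⟨s, hs, hsi⟩ : ∃ s ∈ F, σ s c = i := hi
            rw [if_neg hiB, if_pos ⟨s, hs, hsi, by rw [← hsi]; exact hxs s hs (hsi ▸ hiB)⟩]
        · rw [if_neg hi, if_neg hi]
    · simp [hDD, hu]
  have hLw : ∑ l, w l ≤ Real.exp ω * Real.exp (-C) := by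
    calc ∑ l, w l ≤ ∑ _l : L, Real.exp C :=
          Finset.sum_le_sum fun l _ => Real.exp_le_exp.2 ((le_abs_self _).trans (hC _))
      _ = Fintype.card L * Real.exp (2 * C) * Real.exp (-C) := by
          rw [mul_assoc, ← Real.exp_add]; simp; left; ring
      _ ≤ _ := mul_le_mul_of_nonneg_right hL (Real.exp_pos _).le
  have hC0 : 0 ≤ C := (abs_nonneg _).trans (hC x₀)
  have hupper : ∀ j, (∑ x ∈ DD j, ∏ i, if T j i then ∑ l, u j x i l else 1) ^ p j ≤
      Real.exp (Sum.elim (fun c => (ω * (F.filter fun s => σ s c ∈ B).card + κ * F.card + q) * r c)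
        (fun a => ω * (1 - S a)) j) := by
    have hnn : ∀ j, 0 ≤ ∑ x ∈ DD j, ∏ i, if T j i then ∑ l, u j x i l else 1 := fun j =>
      Finset.sum_nonneg fun x _ => Finset.prod_nonneg fun i _ => by
        split_ifs; exacts [Finset.sum_nonneg fun l _ => hu0 _ _ _ _, zero_le_one]
    rintro (c | a)
    · by_cases hc : c ∈ Z
      · simp [hp, hr, hc]
      · rw [Sum.elim_inl, Real.exp_mul]
        refine Real.rpow_le_rpow (hnn _) ?_ (hr0 c)
        have hx : ∀ x, (∏ i, if T (Sum.inl c) i then ∑ l, u (Sum.inl c) x i l else 1) ≤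
            Real.exp (ω * (F.filter fun s => σ s c ∈ B).card + κ * F.card) *
              Real.exp (∑ s ∈ F, f (α s x)) := by
          intro x
          have himg : (Finset.univ.filter fun i => T (Sum.inl c) i) = F.image fun s => σ s c := by
            ext i; simp [hTdef, hP]
          rw [← Finset.prod_filter, himg, Finset.prod_image (hZ c hc)]
          have hs : ∀ s ∈ F, ∑ l, u (Sum.inl c) x (σ s c) l ≤
              Real.exp (((if σ s c ∈ B then ω else 0) + κ) + f (α s x)) := by
            intro s hs
            simp only [hu, Sum.elim_inl]
            by_cases hB : σ s c ∈ B
            · simp only [if_pos hB]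
              refine hLw.trans ?_
              rw [← Real.exp_add]
              have := (abs_le.1 (hC (α s x))).1
              exact Real.exp_le_exp.2 (by linarith)
            · simp only [if_neg hB]
              have e : ∀ l, (∃ s' ∈ F, σ s' c = σ s c ∧ lab (α s' x) = l) ↔ lab (α s x) = l := by
                intro l
                constructor
                · rintro ⟨s', hs', h, rfl⟩
                  rw [hZ c hc hs' hs h]
                · exact fun h => ⟨s, hs, rfl, h⟩
              simp only [e, Finset.sum_ite_eq, Finset.mem_univ, if_true]
              have := (abs_le.1 (hrep (α s x))).1
              exact Real.exp_le_exp.2 (by linarith)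
          refine (Finset.prod_le_prod (fun s _ => Finset.sum_nonneg fun l _ => hu0 _ _ _ _)
            hs).trans (le_of_eq ?_)
          rw [← Real.exp_sum, ← Real.exp_add, Finset.sum_add_distrib, Finset.sum_add_distrib,
            ← Finset.sum_filter]
          simp [mul_comm]
        refine (Finset.sum_le_sum fun x _ => hx x).trans ?_
        rw [← Finset.mul_sum, Real.exp_add _ q]
        exact mul_le_mul_of_nonneg_left hq (Real.exp_pos _).le
    · rw [Sum.elim_inr, Real.exp_mul]
      refine Real.rpow_le_rpow (hnn _) ?_ (hp0 (Sum.inr a))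
      have : ∑ l, w l ≤ Real.exp ω := hLw.trans
        (mul_le_of_le_one_right (Real.exp_pos _).le (Real.exp_le_one_iff.2 (by linarith)))
      simpa [hDD, hu, hTdef] using this
  have hBsum : ∑ c, ((F.filter fun s => σ s c ∈ B).card : ℝ) = F.card * B.card := by
    simp only [Finset.card_filter, Nat.cast_sum]
    rw [Finset.sum_comm]
    have e : ∀ s ∈ F, ∑ c, (((if σ s c ∈ B then 1 else 0 : ℕ)) : ℝ) = B.card := fun s _ => by
      rw [Equiv.sum_comp (σ s) fun c => (((if c ∈ B then 1 else 0 : ℕ)) : ℝ)]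
      simp
    rw [Finset.sum_congr rfl e]
    simp
  have hexp : ∑ j : J, Sum.elim
      (fun c => (ω * (F.filter fun s => σ s c ∈ B).card + κ * F.card + q) * r c)
        (fun a => ω * (1 - S a)) j ≤
      κ * d + q / F.card * d + ω * (B.card + Z.card) + C * Z.card := by
    rw [Fintype.sum_sum_type]
    simp only [Sum.elim_inl, Sum.elim_inr, add_mul, Finset.sum_add_distrib]
    have hrs : ∑ c, r c = (d - Z.card) / F.card := by
      rw [eq_div_iff hk.ne', Finset.sum_mul, hrsum]
    have h1 : ∑ c, ω * ((F.filter fun s => σ s c ∈ B).card : ℝ) * r c ≤ ω * B.card := by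
      calc ∑ c, ω * ((F.filter fun s => σ s c ∈ B).card : ℝ) * r c
          ≤ ∑ c, ω * ((F.filter fun s => σ s c ∈ B).card : ℝ) * (1 / F.card) :=
            Finset.sum_le_sum fun c _ => mul_le_mul_of_nonneg_left (hrle c) (by positivity)
        _ = ω * B.card := by
            rw [← Finset.sum_mul, ← Finset.mul_sum, hBsum]; field_simp
    have h2 : ∑ c, κ * F.card * r c ≤ κ * d := by
      rw [← Finset.mul_sum, hrs, mul_assoc, mul_div_cancel₀ _ hk.ne']
      exact mul_le_mul_of_nonneg_left (by linarith [(Nat.cast_nonneg Z.card : (0 : ℝ) ≤ _)]) hκ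
    have h3 : ∑ c, q * r c ≤ q / F.card * d + C * Z.card := by
      rw [← Finset.mul_sum, hrs]
      have h : -C ≤ q / F.card := by rw [le_div_iff₀ hk]; linarith
      have e : q * ((d - Z.card) / F.card) = q / F.card * d - q / F.card * Z.card := by ring
      rw [e]
      have := mul_le_mul_of_nonneg_right h (Nat.cast_nonneg Z.card : (0 : ℝ) ≤ _)
      linarith
    have h4 : ∑ a, ω * (1 - S a) = ω * Z.card := by
      rw [← Finset.mul_sum, Finset.sum_sub_distrib, hSsum, hrsum]
      simp
    linarith
  calc ∑ φ ∈ E, Real.exp (∑ a, f (φ a))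
      ≤ ∑ φ ∈ E, Real.exp (κ * d) * g fun a => lab (φ a) := Finset.sum_le_sum hlower
    _ = Real.exp (κ * d) * ∑ y ∈ E.image fun φ a => lab (φ a), g y := by
        rw [← Finset.mul_sum, Finset.sum_image]
        exact fun φ hφ ψ hψ h => hinj φ hφ ψ hψ fun a => congrFun h a
    _ ≤ Real.exp (κ * d) * ∑ y, g y := mul_le_mul_of_nonneg_left
        (Finset.sum_le_sum_of_subset_of_nonneg (Finset.subset_univ _) fun y _ _ => hg0 y)
        (Real.exp_pos _).le
    _ ≤ Real.exp (κ * d) * Real.exp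
          (κ * d + q / F.card * d + ω * (B.card + Z.card) + C * Z.card) := by
        refine mul_le_mul_of_nonneg_left (finner.trans ?_) (Real.exp_pos _).le
        refine (Finset.prod_le_prod (fun j _ => Real.rpow_nonneg ?_ _)
          fun j _ => hupper j).trans ?_
        · exact Finset.sum_nonneg fun x _ => Finset.prod_nonneg fun i _ => by
            split_ifs; exacts [Finset.sum_nonneg fun l _ => hu0 _ _ _ _, zero_le_one]
        · rw [← Real.exp_sum]
          exact Real.exp_le_exp.2 hexp
    _ = _ := by rw [← Real.exp_add]; congr 1; ring

/-- The number of subsets of `[d]` of small proportion grows at a small exponential rate. -/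
theorem exists_card_small_subsets_le {κ : ℝ} (hκ : 0 < κ) :
    ∃ η₀ > 0, ∀ η ≤ η₀, ∀ d : ℕ,
      (((Finset.univ : Finset (Finset (Fin d))).filter fun B => (B.card : ℝ) ≤ η * d).card : ℝ) ≤
        Real.exp (κ * d) := by
  set l : ℝ := 2 / κ with hl
  have hlpos : 0 < l := by positivity
  have hx : Real.exp (-l) ≤ κ / 2 := by
    rw [Real.exp_neg, inv_le_comm₀ (Real.exp_pos _) (by positivity), inv_div]
    linarith [Real.add_one_le_exp l]
  refine ⟨κ / (2 * (l + 1)), by positivity, fun η hη d => ?_⟩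
  have hd : (0 : ℝ) ≤ d := Nat.cast_nonneg d
  have hη' : l * η ≤ κ / 2 := by
    rw [le_div_iff₀ (by positivity)] at hη
    rcases le_or_gt 0 η with h | h
    · nlinarith
    · have := mul_neg_of_pos_of_neg hlpos h
      linarith
  have hsum : ∑ B : Finset (Fin d), Real.exp (-l) ^ B.card = (Real.exp (-l) + 1) ^ d := by
    have := Fintype.sum_pow_mul_eq_add_pow (Fin d) (Real.exp (-l)) 1
    simpa using this
  calc (((Finset.univ : Finset (Finset (Fin d))).filter fun B => (B.card : ℝ) ≤ η * d).card : ℝ)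
      = ∑ B : Finset (Fin d) with (B.card : ℝ) ≤ η * d, (1 : ℝ) := by simp
    _ ≤ ∑ B : Finset (Fin d) with (B.card : ℝ) ≤ η * d,
          Real.exp (-l) ^ B.card * Real.exp (l * (η * d)) := by
        refine Finset.sum_le_sum fun B hB => ?_
        rw [← Real.exp_nat_mul, ← Real.exp_add]
        refine Real.one_le_exp ?_
        have := mul_le_mul_of_nonneg_left (Finset.mem_filter.1 hB).2 hlpos.le
        linarith
    _ ≤ ∑ B : Finset (Fin d), Real.exp (-l) ^ B.card * Real.exp (l * (η * d)) :=
        Finset.sum_le_sum_of_subset_of_nonneg (Finset.subset_univ _) fun B _ _ => by positivity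
    _ = (Real.exp (-l) + 1) ^ d * Real.exp (l * (η * d)) := by rw [← Finset.sum_mul, hsum]
    _ ≤ Real.exp (κ / 2) ^ d * Real.exp (l * (η * d)) := by
        gcongr
        exact (Real.add_one_le_exp _).trans (Real.exp_le_exp.2 hx)
    _ ≤ Real.exp (κ * d) := by
        rw [← Real.exp_nat_mul, ← Real.exp_add]
        refine Real.exp_le_exp.2 ?_
        nlinarith [mul_le_mul_of_nonneg_right hη' hd]

theorem IsSoficApprox.eventually_card_not_injOn_le {G : Type*} [Group G] {d : ℕ → ℕ}
    {σ : ∀ i, G → Equiv.Perm (Fin (d i))} (hσ : IsSoficApprox G d σ) (F : Finset G) {η : ℝ}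
    (hη : 0 < η) : ∀ᶠ i in atTop,
      ((Finset.univ.filter fun c => ¬ Set.InjOn (fun s => σ i s c) F).card : ℝ) ≤ η * d i := by
  have h1 : ∀ q ∈ F.offDiag, Tendsto (fun i => 1 -
      ((Finset.univ.filter fun a : Fin (d i) => σ i q.1 a ≠ σ i q.2 a).card : ℝ) / (d i : ℝ))
      atTop (nhds 0) := fun q hq => by
    have := (hσ.sep q.1 q.2 (Finset.mem_offDiag.1 hq).2.2).const_sub 1
    rwa [sub_self] at this
  have h2 := tendsto_finsetSum F.offDiag h1
  rw [Finset.sum_const_zero] at h2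
  filter_upwards [h2.eventually_lt_const hη, hσ.dim_top.eventually_gt_atTop 0] with i hi hd
  have hd' : (0 : ℝ) < d i := by exact_mod_cast hd
  have hsub : (Finset.univ.filter fun c => ¬ Set.InjOn (fun s => σ i s c) F) ⊆
      F.offDiag.biUnion fun q => Finset.univ.filter fun a => ¬ σ i q.1 a ≠ σ i q.2 a := by
    intro c hc
    have hc := (Finset.mem_filter.1 hc).2
    simp only [Set.InjOn, not_forall] at hc
    obtain ⟨s, hs, t, ht, hst, hne⟩ := hc
    exact Finset.mem_biUnion.2 ⟨(s, t), Finset.mem_offDiag.2 ⟨hs, ht, hne⟩, by simpa using hst⟩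
  have hcard := (Finset.card_le_card hsub).trans Finset.card_biUnion_le
  have hcard' : ((Finset.univ.filter fun c => ¬ Set.InjOn (fun s => σ i s c) F).card : ℝ) ≤
      ∑ q ∈ F.offDiag, ((Finset.univ.filter fun a => ¬ σ i q.1 a ≠ σ i q.2 a).card : ℝ) := by
    exact_mod_cast hcard
  refine hcard'.trans ?_
  have e : ∀ q ∈ F.offDiag, ((Finset.univ.filter fun a => ¬ σ i q.1 a ≠ σ i q.2 a).card : ℝ) =
      (1 - ((Finset.univ.filter fun a : Fin (d i) => σ i q.1 a ≠ σ i q.2 a).card : ℝ) / (d i : ℝ))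
        * d i := fun q _ => by
    have := Finset.card_filter_add_card_filter_not (s := (Finset.univ : Finset (Fin (d i))))
      (fun a => σ i q.1 a ≠ σ i q.2 a)
    rw [Finset.card_univ, Fintype.card_fin] at this
    rw [sub_mul, one_mul, div_mul_cancel₀ _ hd'.ne', eq_sub_iff_add_eq, add_comm]
    exact_mod_cast this
  rw [Finset.sum_congr rfl e, ← Finset.sum_mul]
  exact mul_le_mul_of_nonneg_right hi.le hd'.le

theorem card_not_equivariant_le {G X : Type*} [Group G] {α : G → X → X} {ρ : X → X → ℝ}
    {F : Finset G} {δ θ : ℝ} (hθ : 0 < θ) {d : ℕ} (hd : 0 < d)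
    {σ : G → Equiv.Perm (Fin d)} {φ : Fin d → X} (hφ : φ ∈ MapSet α ρ F δ σ) :
    ((Finset.univ.filter fun c => ∃ s ∈ F, θ ≤ ρ (α s (φ c)) (φ (σ s c))).card : ℝ) ≤
      F.card * (δ / θ) ^ 2 * d := by
  have hd' : (0 : ℝ) < d := by exact_mod_cast hd
  have hsub : (Finset.univ.filter fun c => ∃ s ∈ F, θ ≤ ρ (α s (φ c)) (φ (σ s c))) ⊆
      F.biUnion fun s => Finset.univ.filter fun c => θ ≤ ρ (α s (φ c)) (φ (σ s c)) := by
    intro c hc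
    simpa using hc
  have hcard : ((Finset.univ.filter fun c =>
      ∃ s ∈ F, θ ≤ ρ (α s (φ c)) (φ (σ s c))).card : ℝ) ≤
      ∑ s ∈ F, ((Finset.univ.filter fun c => θ ≤ ρ (α s (φ c)) (φ (σ s c))).card : ℝ) := by
    exact_mod_cast (Finset.card_le_card hsub).trans Finset.card_biUnion_le
  refine hcard.trans ?_
  have hs : ∀ s ∈ F, ((Finset.univ.filter fun c => θ ≤ ρ (α s (φ c)) (φ (σ s c))).card : ℝ) ≤
      (δ / θ) ^ 2 * d := fun s hs => by
    have h := hφ s hs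
    have hδ : 0 < δ := (Real.sqrt_nonneg _).trans_lt h
    rw [rho2, Real.sqrt_lt' hδ, one_div, inv_mul_lt_iff₀ hd'] at h
    rw [div_pow, div_mul_eq_mul_div, le_div_iff₀ (by positivity)]
    calc ((Finset.univ.filter fun c => θ ≤ ρ (α s (φ c)) (φ (σ s c))).card : ℝ) * θ ^ 2
        = ∑ c with θ ≤ ρ (α s (φ c)) (φ (σ s c)), θ ^ 2 := by simp
      _ ≤ ∑ c with θ ≤ ρ (α s (φ c)) (φ (σ s c)), ρ (α s (φ c)) (φ (σ s c)) ^ 2 :=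
          Finset.sum_le_sum fun c hc => pow_le_pow_left₀ hθ.le (Finset.mem_filter.1 hc).2 2
      _ ≤ ∑ c, ρ (α s (φ c)) (φ (σ s c)) ^ 2 :=
          Finset.sum_le_sum_of_subset_of_nonneg (Finset.subset_univ _) fun c _ _ => sq_nonneg _
      _ ≤ δ ^ 2 * d := by linarith
  refine (Finset.sum_le_sum hs).trans (le_of_eq ?_)
  rw [Finset.sum_const, nsmul_eq_mul, mul_assoc]

/-- The uniform estimate behind the comparison of pressures: up to `6 * κ`, the exponential growth
rate of separated sets of sofic maps is at most the normalized classical weight over any `F`. -/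
theorem exists_sum_exp_le {G : Type*} [Group G] {X : Type*} [TopologicalSpace X] [CompactSpace X]
    [Nonempty X] {α : G → X → X} (hα : ContAction G X α) {d : ℕ → ℕ}
    {σ : ∀ i, G → Equiv.Perm (Fin (d i))} (hσ : IsSoficApprox G d σ) {f : X → ℝ}
    (hf : Continuous f) {ρ : X → X → ℝ} (hρ : IsCompatMetric X ρ) {ε κ : ℝ} (hε : 0 < ε)
    (hκ : 0 < κ) :
    ∃ θ > 0, ∀ F : Finset G, F.Nonempty → ∃ δ > 0, ∀ᶠ i in atTop,
      ∀ E : Finset (Fin (d i) → X), ↑E ⊆ MapSet α ρ F δ (σ i) →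
        (∀ φ ∈ E, ∀ ψ ∈ E, φ ≠ ψ → ε ≤ rhoInf ρ φ ψ) →
        ∑ φ ∈ E, Real.exp (∑ a, f (φ a)) ≤
          Real.exp ((Real.log (Kval α f ρ θ F) / F.card + 6 * κ) * d i) := by
  obtain ⟨C, hC⟩ : ∃ C, ∀ x, |f x| ≤ C := by
    obtain ⟨C, hC⟩ := isCompact_univ.exists_bound_of_continuousOn hf.continuousOn
    exact ⟨C, fun x => hC x (Set.mem_univ x)⟩
  have hC0 : 0 ≤ C := (abs_nonneg _).trans (hC (Classical.arbitrary X))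
  obtain ⟨N, rep, hcode⟩ := hρ.exists_coding hf hε hκ
  set ω : ℝ := Real.log (Fintype.card (Finset (Fin N)) * Real.exp (2 * C)) with hω
  have hcardL : (1 : ℝ) ≤ Fintype.card (Finset (Fin N)) := by
    exact_mod_cast Fintype.card_pos
  have hω0 : 0 ≤ ω := Real.log_nonneg (one_le_mul_of_one_le_of_one_le hcardL
    (Real.one_le_exp (by positivity)))
  have hωL : Fintype.card (Finset (Fin N)) * Real.exp (2 * C) ≤ Real.exp ω := by
    rw [hω, Real.exp_log (by positivity)]
  obtain ⟨η₀, hη₀, hsub⟩ := exists_card_small_subsets_le hκ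
  set η : ℝ := min η₀ (κ / (2 * ω + C + 1)) with hη
  have hηpos : 0 < η := by positivity
  have hηκ : (2 * ω + C) * η ≤ κ := by
    have h : η * (2 * ω + C + 1) ≤ κ := (le_div_iff₀ (by positivity)).1 (min_le_right _ _)
    nlinarith
  obtain ⟨M, lab, θ', hθ', hlab, hbd⟩ := hcode η hηpos
  have hM : (0 : ℝ) < M := by
    obtain ⟨t, -⟩ := hbd 0 Fin.elim0
    exact_mod_cast t.pos
  have hθ : 0 < θ' / 2 := by positivity
  refine ⟨θ' / 2, hθ, fun F hF => ?_⟩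
  have hk : (0 : ℝ) < F.card := by exact_mod_cast hF.card_pos
  obtain ⟨D, hspan, hDK⟩ := hα.exists_spanning hρ.toIsContPseudoMetric hC F hθ
  have hKlow : Real.exp (-(C * F.card)) ≤ Kval α f ρ (θ' / 2) F := by
    obtain ⟨x, hx, -⟩ := hspan (Classical.arbitrary X)
    refine le_trans ?_ hDK
    refine le_trans ?_ (Finset.single_le_sum (f := fun x => Real.exp (∑ s ∈ F, f (α s x)))
      (fun x _ => (Real.exp_pos _).le) hx)
    refine Real.exp_le_exp.2 ?_
    have : -(C * F.card) = ∑ _s ∈ F, -C := by simp [mul_comm]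
    rw [this]
    exact Finset.sum_le_sum fun s _ => (abs_le.1 (hC _)).1
  have hKpos : 0 < Kval α f ρ (θ' / 2) F := (Real.exp_pos _).trans_le hKlow
  set q : ℝ := Real.log (Kval α f ρ (θ' / 2) F) with hq
  have hqC : -(C * F.card) ≤ q := (Real.le_log_iff_exp_le hKpos).2 hKlow
  rw [← Real.exp_log hKpos] at hDK
  set δ : ℝ := θ' / 2 * Real.sqrt (η / 2 / F.card) with hδ
  have hδθ : F.card * (δ / (θ' / 2)) ^ 2 = η / 2 := by
    rw [hδ, mul_div_cancel_left₀ _ hθ.ne', Real.sq_sqrt (by positivity)]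
    field_simp
  refine ⟨δ, by positivity, ?_⟩
  filter_upwards [hσ.eventually_card_not_injOn_le F (half_pos hηpos),
    hσ.dim_top.eventually_gt_atTop 0,
    (tendsto_natCast_atTop_atTop.comp hσ.dim_top).eventually_ge_atTop (Real.log M / κ)]
    with i hinj hd hdM E hE hsep
  have hMκ : (M : ℝ) ≤ Real.exp (κ * d i) := by
    rw [← Real.log_le_iff_le_exp hM]
    have h : Real.log M / κ ≤ d i := hdM
    rw [div_le_iff₀ hκ] at h
    linarith
  choose tt htt using hbd (d i)
  set Bf : (Fin (d i) → X) → Finset (Fin (d i)) := fun φ => Finset.univ.filter fun a =>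
    ∃ x', ρ (φ a) x' < θ' ∧ lab (tt φ) x' ≠ lab (tt φ) (φ a) with hBf
  set Zf : (Fin (d i) → X) → Finset (Fin (d i)) := fun φ =>
    (Finset.univ.filter fun c => ¬ Set.InjOn (fun s => σ i s c) F) ∪
      Finset.univ.filter fun c => ∃ s ∈ F, θ' / 2 ≤ ρ (α s (φ c)) (φ (σ i s c)) with hZf
  set S : Finset (Finset (Fin (d i))) :=
    Finset.univ.filter fun B => (B.card : ℝ) ≤ η * d i with hS
  have hSmem : ∀ {B}, B ∈ S → (B.card : ℝ) ≤ η * d i := fun h => (Finset.mem_filter.1 h).2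
  have hScard : (S.card : ℝ) ≤ Real.exp (κ * d i) := hsub η (min_le_left _ _) _
  have hmaps : ∀ φ ∈ E, (tt φ, Bf φ, Zf φ) ∈ (Finset.univ : Finset (Fin M)) ×ˢ S ×ˢ S := by
    intro φ hφ
    refine Finset.mem_product.2 ⟨Finset.mem_univ _, Finset.mem_product.2
      ⟨Finset.mem_filter.2 ⟨Finset.mem_univ _, htt φ⟩, Finset.mem_filter.2 ⟨Finset.mem_univ _, ?_⟩⟩⟩
    have h1 := card_not_equivariant_le hθ hd (hE hφ)
    rw [hδθ] at h1
    have h2 : ((Zf φ).card : ℝ) ≤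
        ((Finset.univ.filter fun c => ¬ Set.InjOn (fun s => σ i s c) F).card : ℝ) +
          ((Finset.univ.filter fun c => ∃ s ∈ F, θ' / 2 ≤ ρ (α s (φ c)) (φ (σ i s c))).card : ℝ) := by
      exact_mod_cast Finset.card_union_le _ _
    linarith
  have hfib : ∀ b ∈ (Finset.univ : Finset (Fin M)) ×ˢ S ×ˢ S,
      ∑ φ ∈ E with (tt φ, Bf φ, Zf φ) = b, Real.exp (∑ a, f (φ a)) ≤
        Real.exp ((q / F.card + 3 * κ) * d i) := by
    rintro ⟨t, B, Z⟩ hb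
    obtain ⟨-, hb⟩ := Finset.mem_product.1 hb
    obtain ⟨hB, hZ⟩ := Finset.mem_product.1 hb
    have hB' := hSmem hB
    have hZ' := hSmem hZ
    by_cases hne : (E.filter fun φ => (tt φ, Bf φ, Zf φ) = (t, B, Z)).Nonempty
    swap
    · rw [Finset.not_nonempty_iff_eq_empty.1 hne, Finset.sum_empty]
      exact (Real.exp_pos _).le
    have hmem : ∀ {φ}, φ ∈ (E.filter fun φ => (tt φ, Bf φ, Zf φ) = (t, B, Z)) →
        φ ∈ E ∧ tt φ = t ∧ Bf φ = B ∧ Zf φ = Z := fun h => by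
      simpa using h
    refine (sum_exp_le_of_labelling (σ i) α hC hκ.le rep (lab t) (fun x => (hlab t x).2.le) hF D B Z
      _ ?_ ?_ ?_ hDK hqC hω0 hωL (Classical.arbitrary X)).trans (Real.exp_le_exp.2 ?_)
    · intro φ hφ ψ hψ hφψ
      by_contra hneq
      have h := hsep φ (hmem hφ).1 ψ (hmem hψ).1 hneq
      have hlt : ∀ a, ρ (φ a) (ψ a) < ε := fun a => by
        have h1 := (hlab t (φ a)).1
        have h2 := (hlab t (ψ a)).1
        rw [← hφψ a, hρ.symm] at h2
        linarith [hρ.triangle (φ a) (rep (lab t (φ a))) (ψ a)]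
      have : Nonempty (Fin (d i)) := ⟨⟨0, hd⟩⟩
      obtain ⟨a, ha⟩ := exists_eq_ciSup_of_finite (f := fun a => ρ (φ a) (ψ a))
      rw [rhoInf, ← ha] at h
      exact absurd h (not_le.2 (hlt a))
    · intro φ hφ c hc
      obtain ⟨-, ht, hBφ, hZφ⟩ := hmem hφ
      obtain ⟨x, hx, hxs⟩ := hspan (φ c)
      refine ⟨x, hx, fun s hs hsB => ?_⟩
      have h1 : ρ (α s (φ c)) (φ (σ i s c)) < θ' / 2 := by
        by_contra! h
        exact hc (hZφ ▸ Finset.mem_union_right _ (Finset.mem_filter.2 ⟨Finset.mem_univ _, s, hs, h⟩))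
      by_contra hl
      refine hsB (hBφ ▸ Finset.mem_filter.2 ⟨Finset.mem_univ _, α s x, ?_, ht ▸ hl⟩)
      have h2 := hρ.triangle (φ (σ i s c)) (α s (φ c)) (α s x)
      have h3 := hxs s hs
      rw [hρ.symm (φ (σ i s c)) (α s (φ c))] at h2
      show ρ (φ (σ i s c)) (α s x) < θ'
      linarith
    · intro c hc
      obtain ⟨φ, hφ⟩ := hne
      obtain ⟨-, -, -, hZφ⟩ := hmem hφ
      by_contra h
      exact hc (hZφ ▸ Finset.mem_union_left _ (Finset.mem_filter.2 ⟨Finset.mem_univ _, h⟩))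
    · have h1 : ω * (B.card + Z.card) + C * Z.card ≤ (2 * ω + C) * η * d i := by
        have := mul_le_mul_of_nonneg_left hB' hω0
        have := mul_le_mul_of_nonneg_left hZ' hω0
        have := mul_le_mul_of_nonneg_left hZ' hC0
        linarith
      have h2 := mul_le_mul_of_nonneg_right hηκ (Nat.cast_nonneg (d i) : (0 : ℝ) ≤ _)
      linarith
  rw [← Finset.sum_fiberwise_of_maps_to hmaps]
  refine (Finset.sum_le_sum hfib).trans ?_
  rw [Finset.sum_const, nsmul_eq_mul, Finset.card_product, Finset.card_product, Finset.card_univ,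
    Fintype.card_fin]
  push_cast
  calc (M : ℝ) * (S.card * S.card) * Real.exp ((q / F.card + 3 * κ) * d i)
      ≤ Real.exp (κ * d i) * (Real.exp (κ * d i) * Real.exp (κ * d i)) *
          Real.exp ((q / F.card + 3 * κ) * d i) := by gcongr
    _ = _ := by
        rw [← Real.exp_add, ← Real.exp_add, ← Real.exp_add]
        congr 1
        ring

theorem stmt4 {G : Type*} [Group G] [Countable G]
    {X : Type*} [TopologicalSpace X] [CompactSpace X] [TopologicalSpace.MetrizableSpace X]
    (α : G → X → X) (hα : ContAction G X α)
    (d : ℕ → ℕ) (σ : ∀ i, G → Equiv.Perm (Fin (d i))) (hσ : IsSoficApprox G d σ) [DecidableEq G]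
    (f : X → ℝ) (hf : Continuous f)
    (ρ : X → X → ℝ) (hρ : IsCompatMetric X ρ)
    (Fol : ℕ → Finset G) (hFol : IsFolnerSeq G Fol) :
    PressureInf α f ρ d σ ≤
      ⨆ (ε : ℝ) (_ : 0 < ε),
        Filter.limsup (fun n => (((Real.log (Kval α f ρ ε (Fol n))) / ((Fol n).card : ℝ) : ℝ) : EReal)) atTop := by
  refine iSup₂_le fun ε hε => ?_
  rcases isEmpty_or_nonempty X with hX | hX
  · refine (iInf₂_le (Fol 0) (hFol.1 0)).trans ((iInf₂_le 1 one_pos).trans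
      (le_trans (limsup_le_of_le (by isBoundedDefault) ?_) bot_le))
    filter_upwards [hσ.dim_top.eventually_gt_atTop 0] with i hd
    rw [if_neg]
    rintro ⟨φ, -⟩
    exact hX.elim (φ ⟨0, hd⟩)
  refine EReal.le_of_forall_lt_iff_le.1 fun z hz => ?_
  obtain ⟨z', hz', hzz'⟩ := EReal.lt_iff_exists_real_btwn.1 hz
  have hzz : z' < z := by exact_mod_cast hzz'
  obtain ⟨θ, hθ, h⟩ := exists_sum_exp_le hα hσ hf hρ hε (by linarith : 0 < (z - z') / 6)
  have hlim := (le_iSup₂ (f := fun (ε : ℝ) (_ : 0 < ε) => Filter.limsup (fun n =>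
    (((Real.log (Kval α f ρ ε (Fol n))) / ((Fol n).card : ℝ) : ℝ) : EReal)) atTop) θ hθ).trans_lt hz'
  obtain ⟨n, hn⟩ := (eventually_lt_of_limsup_lt hlim (by isBoundedDefault)).exists
  have hn' : Real.log (Kval α f ρ θ (Fol n)) / ((Fol n).card : ℝ) < z' := by exact_mod_cast hn
  obtain ⟨δ, hδ, hev⟩ := h (Fol n) (hFol.1 n)
  refine (iInf₂_le (Fol n) (hFol.1 n)).trans ((iInf₂_le δ hδ).trans
    (limsup_le_of_le (by isBoundedDefault) ?_))
  filter_upwards [hev, hσ.dim_top.eventually_gt_atTop 0] with i hi hd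
  have hd' : (0 : ℝ) < d i := by exact_mod_cast hd
  split_ifs with hne
  swap
  · exact bot_le
  obtain ⟨φ, hφ⟩ := hne
  rw [EReal.coe_le_coe_iff, div_le_iff₀ hd']
  have hle : ∀ r ∈ {r : ℝ | ∃ E : Finset (Fin (d i) → X), ↑E ⊆ MapSet α ρ (Fol n) δ (σ i) ∧
      (∀ φ ∈ E, ∀ ψ ∈ E, φ ≠ ψ → ε ≤ rhoInf ρ φ ψ) ∧
      r = ∑ φ ∈ E, Real.exp (∑ a, f (φ a))}, r ≤ Real.exp (z * d i) := by
    rintro _ ⟨E, hE, hsep, rfl⟩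
    refine (hi E hE hsep).trans (Real.exp_le_exp.2 (mul_le_mul_of_nonneg_right ?_ hd'.le))
    linarith
  have hpos : 0 < Mval α f ρ ε (Fol n) δ (σ i) (rhoInf ρ) :=
    (Real.exp_pos (∑ a, f (φ a))).trans_le (le_csSup ⟨_, hle⟩ ⟨{φ}, by simpa using hφ, by simp, by simp⟩)
  rw [Real.log_le_iff_le_exp hpos]
  exact csSup_le ⟨0, ∅, by simp, by simp, by simp⟩ hle

end Sofic
end

section
/- Let α be a continuous action of a countable sofic group G on a compact metrizable space X with sofic approximation sequence Σ, let f : X → ℝ be continuous, and let ρ be a continuous pseudometric on X such that f is uniformly continuous with respect to ρ (i.e. for every θ > 0 there is ε > 0 such that |f(x) − f(y)| < θ whenever ρ(x,y) < ε). Then P_{Σ,2}(f,X,G,ρ) = P_{Σ,∞}(f,X,G,ρ). -/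
open Filter MeasureTheory
open scoped Pointwise Classical BigOperators

namespace Sofic

/-- Pairwise `ε`-separation of a finite set with respect to a distance-like function. -/
def IsSep {β : Type*} (s : β → β → ℝ) (ε : ℝ) (E : Finset β) : Prop :=
  ∀ φ ∈ E, ∀ ψ ∈ E, φ ≠ ψ → ε ≤ s φ ψ

theorem IsSep.mono {β : Type*} {s : β → β → ℝ} {ε : ℝ} {E B : Finset β} (h : IsSep s ε E)
    (hB : B ⊆ E) : IsSep s ε B :=
  fun φ hφ ψ hψ => h φ (hB hφ) ψ (hB hψ)

theorem exists_sep_net {β : Type*} (s : β → β → ℝ) (ε : ℝ) (hself : ∀ x, s x x < ε)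
    (hsymm : ∀ x y, s x y = s y x) (E : Finset β) :
    ∃ B ⊆ E, IsSep s ε B ∧ ∀ ψ ∈ E, ∃ φ ∈ B, s ψ φ < ε := by
  induction E using Finset.induction_on with
  | empty => exact ⟨∅, by simp, by simp [IsSep], by simp⟩
  | insert x E _ ih =>
    obtain ⟨B, hBE, hsep, hnet⟩ := ih
    by_cases h : ∃ φ ∈ B, s x φ < ε
    · refine ⟨B, hBE.trans (Finset.subset_insert _ _), hsep, fun ψ hψ => ?_⟩
      rcases Finset.mem_insert.1 hψ with rfl | hψ
      · exact h
      · exact hnet ψ hψ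
    · push Not at h
      refine ⟨insert x B, Finset.insert_subset_insert _ hBE, fun φ hφ ψ hψ hne => ?_,
        fun ψ hψ => ?_⟩
      · rcases Finset.mem_insert.1 hφ with rfl | hφ' <;>
          rcases Finset.mem_insert.1 hψ with rfl | hψ'
        · exact absurd rfl hne
        · exact h ψ hψ'
        · rw [hsymm]; exact h φ hφ'
        · exact hsep φ hφ' ψ hψ' hne
      · rcases Finset.mem_insert.1 hψ with rfl | hψ
        · exact ⟨ψ, Finset.mem_insert_self _ _, hself ψ⟩
        · obtain ⟨φ, hφ, hlt⟩ := hnet ψ hψ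
          exact ⟨φ, Finset.mem_insert_of_mem hφ, hlt⟩

theorem sum_le_sum_univ_of_injOn {β κ : Type*} [Fintype κ] (E : Finset β) (u : β → ℝ)
    (w : κ → ℝ) (g : β → κ) (hg : Set.InjOn g E) (hw : ∀ k, 0 ≤ w k)
    (huw : ∀ x ∈ E, u x ≤ w (g x)) : ∑ x ∈ E, u x ≤ ∑ k, w k := by
  calc ∑ x ∈ E, u x ≤ ∑ x ∈ E, w (g x) := Finset.sum_le_sum huw
    _ = ∑ k ∈ E.image g, w k := (Finset.sum_image hg).symm
    _ ≤ ∑ k, w k := Finset.sum_le_univ_sum_of_nonneg hw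

section Distances

variable {X : Type*} {ρ : X → X → ℝ} {d : ℕ}

theorem rho2_self (hrefl : ∀ x, ρ x x = 0) (φ : Fin d → X) : rho2 ρ φ φ = 0 := by
  simp [rho2, hrefl]

theorem rho2_symm (hsymm : ∀ x y, ρ x y = ρ y x) (φ ψ : Fin d → X) :
    rho2 ρ φ ψ = rho2 ρ ψ φ := by
  simp only [rho2, fun a => hsymm (φ a) (ψ a)]

theorem sum_sq_le_of_rho2_lt {φ ψ : Fin d → X} {η : ℝ} (hd : 0 < d) (h : rho2 ρ φ ψ < η) :
    ∑ a, ρ (φ a) (ψ a) ^ 2 ≤ d * η ^ 2 := by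
  have hη : 0 < η := lt_of_le_of_lt (Real.sqrt_nonneg _) h
  have h1 := (Real.sqrt_lt' hη).1 h
  have hd' : (0 : ℝ) < d := by exact_mod_cast hd
  rw [one_div, inv_mul_lt_iff₀ hd'] at h1
  exact h1.le

theorem le_rhoInf (φ ψ : Fin d → X) (a : Fin d) : ρ (φ a) (ψ a) ≤ rhoInf ρ φ ψ :=
  le_ciSup (f := fun a => ρ (φ a) (ψ a)) (Set.finite_range _).bddAbove a

theorem exists_rhoInf_eq (hd : 0 < d) (φ ψ : Fin d → X) :
    ∃ a, ρ (φ a) (ψ a) = rhoInf ρ φ ψ := by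
  have : Nonempty (Fin d) := ⟨⟨0, hd⟩⟩
  exact exists_eq_ciSup_of_finite

theorem rho2_le_rhoInf (hnonneg : ∀ x y, 0 ≤ ρ x y) (hd : 0 < d) (φ ψ : Fin d → X) :
    rho2 ρ φ ψ ≤ rhoInf ρ φ ψ := by
  have hd' : (0 : ℝ) < d := by exact_mod_cast hd
  refine Real.sqrt_le_iff.2 ⟨(hnonneg _ _).trans (le_rhoInf φ ψ ⟨0, hd⟩), ?_⟩
  rw [one_div, inv_mul_le_iff₀ hd']
  calc ∑ a, ρ (φ a) (ψ a) ^ 2 ≤ ∑ _a : Fin d, rhoInf ρ φ ψ ^ 2 :=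
        Finset.sum_le_sum fun a _ => pow_le_pow_left₀ (hnonneg _ _) (le_rhoInf φ ψ a) 2
    _ = d * rhoInf ρ φ ψ ^ 2 := by simp

end Distances

section Counting

variable {X : Type*} [TopologicalSpace X] {ρ : X → X → ℝ}

theorem IsContPseudoMetric.exists_finite_net_s6 [CompactSpace X] (hρ : IsContPseudoMetric X ρ)
    {ε : ℝ} (hε : 0 < ε) : ∃ Y : Finset X, ∀ x, ∃ y : Y, ρ x y < ε := by
  have hopen : ∀ y, IsOpen {x | ρ x y < ε} := fun y =>
    isOpen_lt (hρ.cont.comp (Continuous.prodMk continuous_id continuous_const)) continuous_const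
  obtain ⟨Y, hY⟩ := CompactSpace.elim_nhds_subcover (fun y => {x | ρ x y < ε})
    fun y => (hopen y).mem_nhds (by simpa [hρ.refl] using hε)
  refine ⟨Y, fun x => ?_⟩
  have hx : x ∈ ⋃ y ∈ Y, {x | ρ x y < ε} := hY ▸ Set.mem_univ x
  simp only [Set.mem_iUnion] at hx
  obtain ⟨y, hy, hxy⟩ := hx
  exact ⟨⟨y, hy⟩, hxy⟩

/-- A `rhoInf`-separated set has exponentially bounded weight. -/
theorem IsContPseudoMetric.sum_exp_le_of_isSep (hρ : IsContPseudoMetric X ρ) {f : X → ℝ}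
    {C ε : ℝ} (hC : ∀ x, |f x| ≤ C) {Y : Finset X} (hY : ∀ x, ∃ y : Y, ρ x y < ε / 2)
    {d : ℕ} (hd : 0 < d) {E : Finset (Fin d → X)} (hE : IsSep (rhoInf ρ) ε E) :
    ∑ φ ∈ E, Real.exp (∑ a, f (φ a)) ≤ ∑ _g : Fin d → Y, Real.exp (d * C) := by
  choose y hy using hY
  refine sum_le_sum_univ_of_injOn E _ _ (fun φ a => y (φ a)) ?_ (fun _ => (Real.exp_pos _).le) ?_
  · intro φ hφ ψ hψ heq
    by_contra hne
    obtain ⟨a, ha⟩ := exists_rhoInf_eq (ρ := ρ) hd φ ψ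
    have h1 := hE φ hφ ψ hψ hne
    have h2 := congrFun heq a
    simp only at h2
    have h3 := hy (φ a)
    have h4 := hy (ψ a)
    rw [h2] at h3
    rw [hρ.symm] at h4
    linarith [hρ.triangle (φ a) (y (ψ a)) (ψ a)]
  · intro φ _
    refine Real.exp_le_exp.2 ?_
    calc ∑ a, f (φ a) ≤ ∑ _a : Fin d, C :=
          Finset.sum_le_sum fun a _ => (le_abs_self _).trans (hC _)
      _ = d * C := by simp

/-- The weight of a `rhoInf`-separated set inside a `rho2`-ball around `φ` is comparable with the
weight of `φ`. -/
theorem IsContPseudoMetric.sum_exp_le_of_rho2_lt (hρ : IsContPseudoMetric X ρ) {f : X → ℝ}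
    {C ε θ r η L : ℝ} (hC : ∀ x, |f x| ≤ C) {Y : Finset X}
    (hY : ∀ x, ∃ y : Y, ρ x y < ε / 2) (hr : 0 < r) (hrε : r ≤ ε / 2)
    (hfr : ∀ x y, ρ x y < r → |f x - f y| < θ) (hL : 0 ≤ L) (hLη : L * η ^ 2 ≤ θ * r ^ 2)
    (hLY : Y.card * Real.exp (2 * C - L) ≤ θ)
    {d : ℕ} (hd : 0 < d) {E : Finset (Fin d → X)} (hE : IsSep (rhoInf ρ) ε E)
    (φ : Fin d → X) (hφ : ∀ ψ ∈ E, rho2 ρ ψ φ < η) :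
    ∑ ψ ∈ E, Real.exp (∑ a, f (ψ a)) ≤ Real.exp (d * (3 * θ)) * Real.exp (∑ a, f (φ a)) := by
  choose y hy using hY
  let w : Option Y → ℝ := fun o => o.elim (Real.exp θ) fun _ => Real.exp (2 * C - L)
  let g : (Fin d → X) → Fin d → Option Y :=
    fun ψ a => if ρ (ψ a) (φ a) < r then none else some (y (ψ a))
  have hw : ∀ o, 0 ≤ w o := by
    rintro (_ | _) <;> exact (Real.exp_pos _).le
  have hinj : Set.InjOn g E := by
    intro ψ hψ ψ' hψ' heq
    by_contra hne
    obtain ⟨a, ha⟩ := exists_rhoInf_eq (ρ := ρ) hd ψ ψ'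
    have h1 := hE ψ hψ ψ' hψ' hne
    have h2 := congrFun heq a
    simp only [g] at h2
    split_ifs at h2 with h3 h4
    · rw [hρ.symm] at h4
      linarith [hρ.triangle (ψ a) (φ a) (ψ' a)]
    · have h5 := hy (ψ a)
      have h6 := hy (ψ' a)
      rw [Option.some.inj h2] at h5
      rw [hρ.symm] at h6
      linarith [hρ.triangle (ψ a) (y (ψ' a)) (ψ' a)]
  have hpt : ∀ (ψ : Fin d → X) (a : Fin d),
      Real.exp (f (ψ a) - f (φ a) - L * (ρ (ψ a) (φ a) ^ 2 / r ^ 2)) ≤ w (g ψ a) := by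
    intro ψ a
    have hr2 : 0 < r ^ 2 := by positivity
    by_cases h : ρ (ψ a) (φ a) < r
    · simp only [g, w, if_pos h, Option.elim]
      refine Real.exp_le_exp.2 ?_
      have h1 : 0 ≤ L * (ρ (ψ a) (φ a) ^ 2 / r ^ 2) := by positivity
      linarith [(abs_lt.1 (hfr _ _ h)).2]
    · simp only [g, w, if_neg h, Option.elim]
      refine Real.exp_le_exp.2 ?_
      have h1 : 1 ≤ ρ (ψ a) (φ a) ^ 2 / r ^ 2 := by
        rw [one_le_div hr2]
        exact pow_le_pow_left₀ hr.le (not_lt.1 h) 2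
      have h2 : L * 1 ≤ L * (ρ (ψ a) (φ a) ^ 2 / r ^ 2) := mul_le_mul_of_nonneg_left h1 hL
      linarith [(abs_le.1 (hC (ψ a))).2, (abs_le.1 (hC (φ a))).1]
  have hsum : ∑ k : Fin d → Option Y, ∏ a, w (k a) ≤ Real.exp (d * (2 * θ)) := by
    have h1 : ∑ k : Fin d → Option Y, ∏ a, w (k a) = ∏ _a : Fin d, ∑ o, w o := by
      rw [Finset.prod_univ_sum, Fintype.piFinset_univ]
    have hθ : 0 ≤ θ := le_trans (by positivity) hLY
    have h2 : ∑ o, w o ≤ Real.exp (2 * θ) := by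
      have h3 : ∑ o, w o = Real.exp θ + Y.card * Real.exp (2 * C - L) := by
        simp [Fintype.sum_option, w]
      rw [h3, two_mul θ, Real.exp_add]
      nlinarith [Real.add_one_le_exp θ, Real.one_le_exp hθ]
    rw [h1, Finset.prod_const, Finset.card_univ, Fintype.card_fin, Real.exp_nat_mul]
    exact pow_le_pow_left₀ (Finset.sum_nonneg fun o _ => hw o) h2 d
  have hmain : ∀ ψ ∈ E, Real.exp (∑ a, f (ψ a)) ≤
      Real.exp (d * θ) * Real.exp (∑ a, f (φ a)) * ∏ a, w (g ψ a) := by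
    intro ψ hψ
    have h1 : ∏ a, Real.exp (f (ψ a) - f (φ a) - L * (ρ (ψ a) (φ a) ^ 2 / r ^ 2)) ≤
        ∏ a, w (g ψ a) :=
      Finset.prod_le_prod (fun _ _ => (Real.exp_pos _).le) fun a _ => hpt ψ a
    refine le_trans ?_ (mul_le_mul_of_nonneg_left h1 (by positivity))
    rw [← Real.exp_sum, ← Real.exp_add, ← Real.exp_add, Real.exp_le_exp,
      Finset.sum_sub_distrib, Finset.sum_sub_distrib, ← Finset.mul_sum, ← Finset.sum_div]
    have h2 := sum_sq_le_of_rho2_lt hd (hφ ψ hψ)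
    have h3 : L * ((∑ a, ρ (ψ a) (φ a) ^ 2) / r ^ 2) ≤ d * θ := by
      rw [← mul_div_assoc, div_le_iff₀ (by positivity)]
      calc L * ∑ a, ρ (ψ a) (φ a) ^ 2 ≤ L * (d * η ^ 2) := mul_le_mul_of_nonneg_left h2 hL
        _ = d * (L * η ^ 2) := by ring
        _ ≤ d * (θ * r ^ 2) := mul_le_mul_of_nonneg_left hLη (Nat.cast_nonneg _)
        _ = d * θ * r ^ 2 := by ring
    linarith
  calc ∑ ψ ∈ E, Real.exp (∑ a, f (ψ a))
      ≤ ∑ k : Fin d → Option Y,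
          Real.exp (d * θ) * Real.exp (∑ a, f (φ a)) * ∏ a, w (k a) :=
        sum_le_sum_univ_of_injOn E _
          (fun k => Real.exp (d * θ) * Real.exp (∑ a, f (φ a)) * ∏ a, w (k a)) g hinj
          (fun k => mul_nonneg (by positivity) (Finset.prod_nonneg fun a _ => hw _)) hmain
    _ = Real.exp (d * θ) * Real.exp (∑ a, f (φ a)) * ∑ k : Fin d → Option Y, ∏ a, w (k a) := by
        rw [Finset.mul_sum]
    _ ≤ Real.exp (d * θ) * Real.exp (∑ a, f (φ a)) * Real.exp (d * (2 * θ)) :=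
        mul_le_mul_of_nonneg_left hsum (by positivity)
    _ = Real.exp (d * (3 * θ)) * Real.exp (∑ a, f (φ a)) := by
        rw [← Real.exp_add, ← Real.exp_add, ← Real.exp_add]
        congr 1
        ring

/-- A `rhoInf`-separated set contains a `rho2`-separated set of comparable weight. -/
theorem IsContPseudoMetric.exists_rho2_sep_subset [CompactSpace X] (hρ : IsContPseudoMetric X ρ)
    {f : X → ℝ} (hf : Continuous f)
    (huc : ∀ θ : ℝ, 0 < θ → ∃ ε > 0, ∀ x y : X, ρ x y < ε → |f x - f y| < θ)
    {ε θ : ℝ} (hε : 0 < ε) (hθ : 0 < θ) :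
    ∃ η > 0, ∀ (d : ℕ), 0 < d → ∀ E : Finset (Fin d → X), IsSep (rhoInf ρ) ε E →
      ∃ B ⊆ E, IsSep (rho2 ρ) η B ∧
        ∑ φ ∈ E, Real.exp (∑ a, f (φ a)) ≤
          Real.exp (d * θ) * ∑ φ ∈ B, Real.exp (∑ a, f (φ a)) := by
  obtain ⟨C, hC⟩ : ∃ C, ∀ x, |f x| ≤ C := by
    obtain ⟨C, hC⟩ := isCompact_univ.exists_bound_of_continuousOn hf.continuousOn
    exact ⟨C, fun x => hC x (Set.mem_univ x)⟩
  obtain ⟨Y, hY⟩ := hρ.exists_finite_net_s6 (half_pos hε)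
  obtain ⟨r₀, hr₀, hfr₀⟩ := huc (θ / 3) (by positivity)
  set r := min r₀ (ε / 2) with hrdef
  have hr : 0 < r := lt_min hr₀ (half_pos hε)
  set L : ℝ := 2 * |C| + Y.card / (θ / 3) with hLdef
  have hL : 0 ≤ L := by positivity
  have hLY : Y.card * Real.exp (2 * C - L) ≤ θ / 3 := by
    have h1 : Real.exp (2 * C - L) ≤ Real.exp (-(Y.card / (θ / 3))) := by
      refine Real.exp_le_exp.2 ?_
      linarith [le_abs_self C]
    have h2 : (Y.card / (θ / 3) : ℝ) ≤ Real.exp (Y.card / (θ / 3)) := by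
      linarith [Real.add_one_le_exp (Y.card / (θ / 3) : ℝ)]
    rw [div_le_iff₀ (by positivity)] at h2
    calc Y.card * Real.exp (2 * C - L) ≤ Y.card * Real.exp (-(Y.card / (θ / 3))) :=
          mul_le_mul_of_nonneg_left h1 (Nat.cast_nonneg _)
      _ ≤ θ / 3 := by
          rw [Real.exp_neg, ← div_eq_mul_inv, div_le_iff₀ (Real.exp_pos _)]
          linarith
  set η := Real.sqrt (θ / 3 * r ^ 2 / (L + 1)) with hηdef
  have hη : 0 < η := Real.sqrt_pos.2 (by positivity)
  have hLη : L * η ^ 2 ≤ θ / 3 * r ^ 2 := by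
    rw [hηdef, Real.sq_sqrt (by positivity), ← mul_div_assoc, div_le_iff₀ (by positivity)]
    nlinarith [show 0 ≤ θ / 3 * r ^ 2 by positivity]
  refine ⟨η, hη, fun d hd E hE => ?_⟩
  obtain ⟨B, hBE, hB, hnet⟩ := exists_sep_net (rho2 ρ) η
    (fun φ : Fin d → X => by rw [rho2_self hρ.refl]; exact hη) (rho2_symm hρ.symm) E
  refine ⟨B, hBE, hB, ?_⟩
  choose! c hcB hc using hnet
  rw [← Finset.sum_fiberwise_of_maps_to hcB, Finset.mul_sum]
  refine Finset.sum_le_sum fun φ _ => ?_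
  have h := hρ.sum_exp_le_of_rho2_lt hC hY hr (min_le_right _ _)
    (fun x y hxy => hfr₀ x y (hxy.trans_le (min_le_left _ _))) hL hLη hLY hd
    (hE.mono (Finset.filter_subset (fun ψ => c ψ = φ) E)) φ (fun ψ hψ => by
      obtain ⟨hψE, rfl⟩ := Finset.mem_filter.1 hψ
      exact hc ψ hψE)
  rwa [mul_div_cancel₀ θ (three_ne_zero)] at h

end Counting

section Pressure

variable {G X : Type*} [Group G] {α : G → X → X} {f : X → ℝ} {ρ : X → X → ℝ}

/-- The set of weights of separated sets whose supremum is `Mval`. -/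
def sepWeights (α : G → X → X) (f : X → ℝ) (ρ : X → X → ℝ)
    (ε : ℝ) (F : Finset G) (δ : ℝ) {d : ℕ} (σ : G → Equiv.Perm (Fin d))
    (sepd : (Fin d → X) → (Fin d → X) → ℝ) : Set ℝ :=
  {r : ℝ | ∃ E : Finset (Fin d → X), ↑E ⊆ MapSet α ρ F δ σ ∧ IsSep sepd ε E ∧
    r = ∑ φ ∈ E, Real.exp (∑ a, f (φ a))}

theorem sepWeights_nonempty (ε : ℝ) (F : Finset G) (δ : ℝ) {d : ℕ}
    (σ : G → Equiv.Perm (Fin d)) (sepd : (Fin d → X) → (Fin d → X) → ℝ) :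
    (sepWeights α f ρ ε F δ σ sepd).Nonempty :=
  ⟨0, ∅, by simp, by simp [IsSep], by simp⟩

theorem sSup_sepWeights_pos {ε : ℝ} {F : Finset G} {δ : ℝ} {d : ℕ} {σ : G → Equiv.Perm (Fin d)}
    {sepd : (Fin d → X) → (Fin d → X) → ℝ} (hne : (MapSet α ρ F δ σ).Nonempty)
    (hb : BddAbove (sepWeights α f ρ ε F δ σ sepd)) :
    0 < sSup (sepWeights α f ρ ε F δ σ sepd) := by
  obtain ⟨φ, hφ⟩ := hne
  refine (Real.exp_pos (∑ a, f (φ a))).trans_le (le_csSup hb ⟨{φ}, by simpa using hφ, ?_, by simp⟩)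
  intro x hx y hy hxy
  rw [Finset.mem_singleton] at hx hy
  exact absurd (hx.trans hy.symm) hxy

variable [TopologicalSpace X]

theorem sepWeights_rho2_subset (hρ : IsContPseudoMetric X ρ) (ε : ℝ) (F : Finset G) (δ : ℝ)
    {d : ℕ} (hd : 0 < d) (σ : G → Equiv.Perm (Fin d)) :
    sepWeights α f ρ ε F δ σ (rho2 ρ) ⊆ sepWeights α f ρ ε F δ σ (rhoInf ρ) := by
  rintro _ ⟨E, hE, hsep, rfl⟩
  exact ⟨E, hE, fun φ hφ ψ hψ hne =>
    (hsep φ hφ ψ hψ hne).trans (rho2_le_rhoInf hρ.nonneg hd φ ψ), rfl⟩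

theorem bddAbove_sepWeights_rhoInf [CompactSpace X] (hρ : IsContPseudoMetric X ρ)
    (hf : Continuous f) {ε : ℝ} (hε : 0 < ε) (F : Finset G) (δ : ℝ)
    {d : ℕ} (hd : 0 < d) (σ : G → Equiv.Perm (Fin d)) :
    BddAbove (sepWeights α f ρ ε F δ σ (rhoInf ρ)) := by
  obtain ⟨C, hC⟩ := isCompact_univ.exists_bound_of_continuousOn hf.continuousOn
  obtain ⟨Y, hY⟩ := hρ.exists_finite_net_s6 (half_pos hε)
  refine ⟨∑ _g : Fin d → Y, Real.exp (d * C), ?_⟩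
  rintro _ ⟨E, _, hsep, rfl⟩
  exact hρ.sum_exp_le_of_isSep (fun x => hC x (Set.mem_univ x)) hY hd hsep

theorem pressure2_le_pressureInf [CompactSpace X] (hρ : IsContPseudoMetric X ρ)
    (hf : Continuous f) {d : ℕ → ℕ} (hd : Tendsto d atTop atTop)
    (σ : ∀ i, G → Equiv.Perm (Fin (d i))) :
    Pressure2 α f ρ d σ ≤ PressureInf α f ρ d σ := by
  refine iSup₂_mono fun ε hε => iInf₂_mono fun F _ => iInf₂_mono fun δ _ => ?_
  refine limsup_le_limsup ?_
  filter_upwards [hd.eventually_gt_atTop 0] with i hi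
  split_ifs with hne
  · have hb := bddAbove_sepWeights_rhoInf (α := α) hρ hf hε F δ hi (σ i)
    have hsub := sepWeights_rho2_subset (α := α) (f := f) hρ ε F δ hi (σ i)
    refine EReal.coe_le_coe_iff.2 (div_le_div_of_nonneg_right ?_ (Nat.cast_nonneg _))
    exact Real.log_le_log (sSup_sepWeights_pos hne (hb.mono hsub))
      (csSup_le_csSup hb (sepWeights_nonempty _ _ _ _ _) hsub)
  · exact le_rfl

theorem pressureInf_le_pressure2 [CompactSpace X] (hρ : IsContPseudoMetric X ρ)
    (hf : Continuous f)
    (huc : ∀ θ : ℝ, 0 < θ → ∃ ε > 0, ∀ x y : X, ρ x y < ε → |f x - f y| < θ)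
    {d : ℕ → ℕ} (hd : Tendsto d atTop atTop) (σ : ∀ i, G → Equiv.Perm (Fin (d i))) :
    PressureInf α f ρ d σ ≤ Pressure2 α f ρ d σ := by
  refine iSup₂_le fun ε hε => EReal.le_of_forall_lt_iff_le.1 fun z hz => ?_
  obtain ⟨z', hz', hzz'⟩ := EReal.lt_iff_exists_real_btwn.1 hz
  have hθ : 0 < z - z' := sub_pos.2 (EReal.coe_lt_coe_iff.1 hzz')
  obtain ⟨η, hη, hsub⟩ := hρ.exists_rho2_sep_subset hf huc hε hθ
  have hlt := (le_iSup₂ (f := fun (ε : ℝ) (_ : 0 < ε) => ⨅ (F : Finset G) (_ : F.Nonempty),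
    ⨅ (δ : ℝ) (_ : 0 < δ), Filter.limsup (fun i => if (MapSet α ρ F δ (σ i)).Nonempty then
      (((Real.log (Mval α f ρ ε F δ (σ i) (rho2 ρ))) / (d i : ℝ) : ℝ) : EReal)
      else (⊥ : EReal)) atTop) η hη).trans_lt hz'
  simp only [iInf_lt_iff] at hlt
  obtain ⟨F, hF, δ, hδ, hlim⟩ := hlt
  refine iInf₂_le_of_le F hF (iInf₂_le_of_le δ hδ (limsup_le_of_le (h := ?_)))
  filter_upwards [hd.eventually_gt_atTop 0, eventually_lt_of_limsup_lt hlim] with i hi hui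
  split_ifs at hui ⊢ with hne
  · have hb := bddAbove_sepWeights_rhoInf (α := α) hρ hf hε F δ hi (σ i)
    have hb2 := (bddAbove_sepWeights_rhoInf (α := α) hρ hf hη F δ hi (σ i)).mono
      (sepWeights_rho2_subset hρ η F δ hi (σ i))
    have hdi : (0 : ℝ) < d i := by exact_mod_cast hi
    have hM : Mval α f ρ ε F δ (σ i) (rhoInf ρ) ≤
        Real.exp (d i * (z - z')) * Mval α f ρ η F δ (σ i) (rho2 ρ) := by
      refine csSup_le (sepWeights_nonempty (α := α) (f := f) ε F δ (σ i) (rhoInf ρ)) ?_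
      rintro _ ⟨E, hE, hsep, rfl⟩
      obtain ⟨B, hBE, hB, hle⟩ := hsub (d i) hi E hsep
      refine hle.trans (mul_le_mul_of_nonneg_left ?_ (Real.exp_pos _).le)
      exact le_csSup hb2 ⟨B, fun φ hφ => hE (hBE hφ), hB, rfl⟩
    have hpos : 0 < Mval α f ρ ε F δ (σ i) (rhoInf ρ) := sSup_sepWeights_pos hne hb
    have hpos2 : 0 < Mval α f ρ η F δ (σ i) (rho2 ρ) := sSup_sepWeights_pos hne hb2
    have hlog := Real.log_le_log hpos hM
    rw [Real.log_mul (Real.exp_pos _).ne' hpos2.ne', Real.log_exp] at hlog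
    rw [EReal.coe_lt_coe_iff, div_lt_iff₀ hdi] at hui
    rw [EReal.coe_le_coe_iff, div_le_iff₀ hdi]
    linarith
  · exact bot_le

end Pressure

theorem stmt6 {G : Type*} [Group G] [Countable G]
    {X : Type*} [TopologicalSpace X] [CompactSpace X] [TopologicalSpace.MetrizableSpace X]
    (α : G → X → X) (hα : ContAction G X α)
    (d : ℕ → ℕ) (σ : ∀ i, G → Equiv.Perm (Fin (d i))) (hσ : IsSoficApprox G d σ)
    (f : X → ℝ) (hf : Continuous f)
    (ρ : X → X → ℝ) (hρ : IsContPseudoMetric X ρ)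
    (huc : ∀ θ : ℝ, 0 < θ → ∃ ε > 0, ∀ x y : X, ρ x y < ε → |f x - f y| < θ) :
    Pressure2 α f ρ d σ = PressureInf α f ρ d σ :=
  le_antisymm (pressure2_le_pressureInf hρ hf hσ.dim_top σ)
    (pressureInf_le_pressure2 hρ hf huc hσ.dim_top σ)

end Sofic
end
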